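/- Let W = {W_x}_{x∈𝒳} be a classical-quantum channel with outputs on a finite-dimensional Hilbert space B, and let r ≥ 0. Then for every n ∈ ℕ and every α ∈ [1/2, 1], one has 1 − ε^NS(W^⊗n, e^{nr}) ≤ exp(−n·((1−α)/α)·(Ĩ_α(W) − r)). Consequently liminf_{n→∞} −(1/n) log(1 − ε^NS(W^⊗n, e^{nr})) ≥ sup_{1/2 ≤ α ≤ 1} ((1−α)/α)(Ĩ_α(W) − r). -/

import Mathlib

noncomputable section
open scoped BigOperators
open Classical
open scoped ComplexOrder

namespace ChannelSim

/-! ### Classical definitions -/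

/-- A probability distribution on a finite type. -/
def IsProbDist {Y : Type*} [Fintype Y] (p : Y → ℝ) : Prop :=
  (∀ y, 0 ≤ p y) ∧ ∑ y, p y = 1

/-- A classical channel: a stochastic matrix, i.e. each row is a probability distribution. -/
def IsChannel {X Y : Type*} [Fintype Y] (W : X → Y → ℝ) : Prop :=
  ∀ x, IsProbDist (W x)

/-- The `n`-fold product channel `W^{⊗n}`. -/
def prodChannel {X Y : Type*} (W : X → Y → ℝ) (n : ℕ) :
    (Fin n → X) → (Fin n → Y) → ℝ :=
  fun xs ys => ∏ i, W (xs i) (ys i)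

/-- The `n`-fold product distribution `q^{⊗n}`. -/
def prodDist {Y : Type*} (q : Y → ℝ) (n : ℕ) : (Fin n → Y) → ℝ :=
  fun ys => ∏ i, q (ys i)

/-- Fidelity of probability distributions on a finite type. -/
def cFid {Y : Type*} [Fintype Y] (p q : Y → ℝ) : ℝ :=
  (∑ y, Real.sqrt (p y * q y)) ^ 2

/-- Purified distance of probability distributions on a finite type. -/
def cPD {Y : Type*} [Fintype Y] (p q : Y → ℝ) : ℝ :=
  Real.sqrt (1 - cFid p q)

/-- Non-signaling simulation error of a classical channel with communication size `M`. -/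
def cEpsNS {X Y : Type*} [Fintype X] [Fintype Y] (W : X → Y → ℝ) (M : ℝ) : ℝ :=
  sInf { e : ℝ | ∃ (W' : X → Y → ℝ) (q : Y → ℝ), IsChannel W' ∧ IsProbDist q ∧
    (∀ x y, W' x y ≤ M * q y) ∧ e = ⨆ x, cPD (W x) (W' x) }

/-- Shared-randomness simulation error of a classical channel with communication size `M`. -/
def cEpsSR {X Y : Type*} [Fintype X] [Fintype Y] (W : X → Y → ℝ) (M : ℝ) : ℝ :=
  sInf { e : ℝ | ∃ (k m : ℕ) (pS : Fin k → ℝ) (Enc : X → Fin k → Fin m → ℝ)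
    (Dec : Fin m → Fin k → Y → ℝ),
    IsProbDist pS ∧ (∀ x s, IsProbDist (Enc x s)) ∧ (∀ i s, IsProbDist (Dec i s)) ∧
    (m : ℝ) ≤ M ∧
    e = ⨆ x, cPD (W x) (fun y => ∑ s, pS s * ∑ i, Enc x s i * Dec i s y) }

/-- Classical Rényi divergence of order `α > 0`, with values in the extended reals:
the Kullback–Leibler divergence at `α = 1`, and `+∞` whenever `α > 1` (or `α = 1`)
and the support of `p` is not contained in that of `q`. -/
def cRenyiD {Y : Type*} [Fintype Y] (α : ℝ) (p q : Y → ℝ) : EReal :=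
  if α = 1 then
    (if ∀ y, q y = 0 → p y = 0 then
      ((∑ y, p y * Real.log (p y / q y) : ℝ) : EReal) else (⊤ : EReal))
  else if 1 < α ∧ ¬ (∀ y, q y = 0 → p y = 0) then (⊤ : EReal)
  else (((α - 1)⁻¹ * Real.log (∑ y, p y ^ α * q y ^ (1 - α)) : ℝ) : EReal)

/-- Rényi mutual information `I_α(W) = inf_q sup_x D_α(W(·|x)‖q)` of a classical channel. -/
def cRenyiMI {X Y : Type*} [Fintype X] [Fintype Y] (α : ℝ) (W : X → Y → ℝ) : EReal :=
  ⨅ q : {q : Y → ℝ // IsProbDist q}, ⨆ x, cRenyiD α (W x) q.1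

/-- Kullback–Leibler divergence (real-valued formula, valid on matching supports). -/
def cKL {Y : Type*} [Fintype Y] (p q : Y → ℝ) : ℝ :=
  ∑ y, p y * Real.log (p y / q y)

/-- Relative-entropy variance (real-valued formula, valid on matching supports). -/
def cVar {Y : Type*} [Fintype Y] (p q : Y → ℝ) : ℝ :=
  (∑ y, p y * (Real.log (p y / q y)) ^ 2) - (cKL p q) ^ 2

/-- The empirical type of a word `xs ∈ X^n`. -/
def empType {X : Type*} [Fintype X] {n : ℕ} (xs : Fin n → X) : X → ℝ :=
  fun x => (Finset.univ.filter fun i => xs i = x).card / n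

/-! ### Quantum definitions -/

/-- A density matrix: positive semidefinite with unit trace. -/
def IsDensity {n : Type*} [Fintype n] [DecidableEq n] (ρ : Matrix n n ℂ) : Prop :=
  ρ.PosSemidef ∧ ρ.trace = 1

/-- Functional calculus for Hermitian matrices (junk value `0` on non-Hermitian input). -/
def matFun {n : Type*} [Fintype n] [DecidableEq n] (f : ℝ → ℝ) (A : Matrix n n ℂ) :
    Matrix n n ℂ :=
  if hA : A.IsHermitian then
    (hA.eigenvectorUnitary : Matrix n n ℂ) *
      Matrix.diagonal (fun i => ((f (hA.eigenvalues i)) : ℂ)) *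
      (star (hA.eigenvectorUnitary : Matrix n n ℂ))
  else 0

/-- Fidelity of density matrices: `F(ρ,σ) = (Tr √(√ρ σ √ρ))²`. -/
def qFid {n : Type*} [Fintype n] [DecidableEq n] (ρ σ : Matrix n n ℂ) : ℝ :=
  ((matFun Real.sqrt (matFun Real.sqrt ρ * σ * matFun Real.sqrt ρ)).trace).re ^ 2

/-- Purified distance of density matrices. -/
def qPD {n : Type*} [Fintype n] [DecidableEq n] (ρ σ : Matrix n n ℂ) : ℝ :=
  Real.sqrt (1 - qFid ρ σ)

/-- Non-signaling simulation error of a classical-quantum channel with communication size `M`. -/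
def qEpsNS {X B : Type*} [Fintype X] [Fintype B] [DecidableEq B]
    (W : X → Matrix B B ℂ) (M : ℝ) : ℝ :=
  sInf { e : ℝ | ∃ (W' : X → Matrix B B ℂ) (σ : Matrix B B ℂ),
    (∀ x, IsDensity (W' x)) ∧ IsDensity σ ∧ (∀ x, (M • σ - W' x).PosSemidef) ∧
    e = ⨆ x, qPD (W x) (W' x) }

/-- Support inclusion `supp ρ ⊆ supp σ` for positive semidefinite matrices, expressed
via kernels: every vector killed by `σ` is killed by `ρ`. -/
def suppLE {n : Type*} [Fintype n] (ρ σ : Matrix n n ℂ) : Prop :=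
  ∀ v, σ.mulVec v = 0 → ρ.mulVec v = 0

/-- Umegaki relative entropy `D(ρ‖σ) = Tr ρ (log ρ − log σ)` (logarithms on supports;
real-valued formula, valid when `supp ρ ⊆ supp σ`). -/
def relEntQ {n : Type*} [Fintype n] [DecidableEq n] (ρ σ : Matrix n n ℂ) : ℝ :=
  ((ρ * (matFun Real.log ρ - matFun Real.log σ)).trace).re

/-- Quantum relative-entropy variance `Tr ρ (log ρ − log σ)² − D(ρ‖σ)²`. -/
def varQ {n : Type*} [Fintype n] [DecidableEq n] (ρ σ : Matrix n n ℂ) : ℝ :=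
  ((ρ * (matFun Real.log ρ - matFun Real.log σ) ^ 2).trace).re - (relEntQ ρ σ) ^ 2

/-- Sandwiched Rényi divergence of order `α`, valued in the extended reals:
`D̃_α(ρ‖σ) = (α−1)⁻¹ log Tr (σ^{(1−α)/(2α)} ρ σ^{(1−α)/(2α)})^α`, with the Umegaki relative
entropy at `α = 1`, and `+∞` when `α ≥ 1` and `supp ρ ⊄ supp σ`, or `α < 1` and `ρσ = 0`. -/
def sandD {n : Type*} [Fintype n] [DecidableEq n] (α : ℝ) (ρ σ : Matrix n n ℂ) : EReal :=
  if α = 1 then (if suppLE ρ σ then ((relEntQ ρ σ : ℝ) : EReal) else (⊤ : EReal))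
  else if (1 < α ∧ ¬ suppLE ρ σ) ∨ (α < 1 ∧ ρ * σ = 0) then (⊤ : EReal)
  else (((α - 1)⁻¹ * Real.log
      (((matFun (fun t => t ^ α)
        (matFun (fun t => t ^ ((1 - α) / (2 * α))) σ * ρ *
          matFun (fun t => t ^ ((1 - α) / (2 * α))) σ)).trace).re) : ℝ) : EReal)

/-- Sandwiched Rényi mutual information `Ĩ_α(W) = inf_σ sup_x D̃_α(W_x‖σ)` of a CQ channel. -/
def sandMI {X B : Type*} [Fintype X] [Fintype B] [DecidableEq B]
    (α : ℝ) (W : X → Matrix B B ℂ) : EReal :=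
  ⨅ σ : {σ : Matrix B B ℂ // IsDensity σ}, ⨆ x, sandD α (W x) σ.1

/-- `n`-fold tensor power `ρ^{⊗n}` of a matrix, realized on the index set `Fin n → B`. -/
def tensPow {B : Type*} (ρ : Matrix B B ℂ) (n : ℕ) :
    Matrix (Fin n → B) (Fin n → B) ℂ :=
  Matrix.of fun a b => ∏ i, ρ (a i) (b i)

/-- Tensor product `V_1 ⊗ ⋯ ⊗ V_k` of a family of matrices. -/
def tensProd {B : Type*} {k : ℕ} (V : Fin k → Matrix B B ℂ) :
    Matrix (Fin k → B) (Fin k → B) ℂ :=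
  Matrix.of fun a b => ∏ i, V i (a i) (b i)

/-- The `n`-fold product CQ channel `W^{⊗n}`. -/
def cqPow {X B : Type*} (W : X → Matrix B B ℂ) (n : ℕ) :
    (Fin n → X) → Matrix (Fin n → B) (Fin n → B) ℂ :=
  fun xs => Matrix.of fun a b => ∏ i, W (xs i) (a i) (b i)

/-- Minimal positive eigenvalue of a Hermitian matrix (junk value `0` otherwise). -/
def minPosEig {n : Type*} [Fintype n] [DecidableEq n] (A : Matrix n n ℂ) : ℝ :=
  if hA : A.IsHermitian then sInf {t : ℝ | 0 < t ∧ ∃ i, hA.eigenvalues i = t} else 0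

/-- Extended-real exponential, sending `⊥ = −∞` to `0`. -/
def expE (x : EReal) : ℝ := if x = ⊥ then 0 else Real.exp x.toReal


/-- The joint classical–quantum state `W∘p = Σ_x p(x) |x⟩⟨x| ⊗ W_x` as a block-diagonal
matrix on `ℂ^{|X|} ⊗ B`. -/
def cqJoint {X B : Type*} [DecidableEq X] (p : X → ℝ) (W : X → Matrix B B ℂ) :
    Matrix (X × B) (X × B) ℂ :=
  Matrix.of fun a b => if a.1 = b.1 then (p a.1 : ℂ) * W a.1 a.2 b.2 else 0

end ChannelSim

namespace ChannelSim

open Matrix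

set_option linter.unusedSectionVars false

section

variable {n : Type*} [Fintype n] [DecidableEq n]

/-- The matrix `U diag(v) Uᴴ`. -/
def dg (U : Matrix n n ℂ) (v : n → ℝ) : Matrix n n ℂ :=
  U * diagonal (fun i => (v i : ℂ)) * Uᴴ

lemma dg_mul {U : Matrix n n ℂ} (hU : Uᴴ * U = 1) (v w : n → ℝ) :
    dg U v * dg U w = dg U (fun i => v i * w i) := by
  unfold dg
  calc U * diagonal (fun i => (v i : ℂ)) * Uᴴ * (U * diagonal (fun i => (w i : ℂ)) * Uᴴ)
      = U * diagonal (fun i => (v i : ℂ)) * (Uᴴ * U) * diagonal (fun i => (w i : ℂ)) * Uᴴ := by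
        simp only [Matrix.mul_assoc]
    _ = _ := by
        rw [hU, Matrix.mul_one, Matrix.mul_assoc U, diagonal_mul_diagonal]
        simp

lemma dg_isHermitian (U : Matrix n n ℂ) (v : n → ℝ) : (dg U v).IsHermitian := by
  unfold dg
  apply isHermitian_mul_mul_conjTranspose
  rw [isHermitian_diagonal_iff]
  intro i
  simp [IsSelfAdjoint, Complex.conj_ofReal]

lemma dg_posSemidef (U : Matrix n n ℂ) {v : n → ℝ} (hv : ∀ i, 0 ≤ v i) :
    (dg U v).PosSemidef := by
  unfold dg
  apply PosSemidef.mul_mul_conjTranspose_same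
  rw [posSemidef_diagonal_iff]
  intro i
  exact_mod_cast hv i

lemma dg_trace {U : Matrix n n ℂ} (hU : Uᴴ * U = 1) (v : n → ℝ) :
    (dg U v).trace = ∑ i, (v i : ℂ) := by
  unfold dg
  rw [Matrix.trace_mul_comm, ← Matrix.mul_assoc, hU, Matrix.one_mul, trace_diagonal]

lemma dg_trace_re {U : Matrix n n ℂ} (hU : Uᴴ * U = 1) (v : n → ℝ) :
    (dg U v).trace.re = ∑ i, v i := by
  rw [dg_trace hU]; simp

lemma dg_smul (U : Matrix n n ℂ) (c : ℝ) (v : n → ℝ) :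
    dg U (fun i => c * v i) = c • dg U v := by
  unfold dg
  have : diagonal (fun i => ((c * v i : ℝ) : ℂ)) = c • diagonal (fun i => (v i : ℂ)) := by
    ext i j
    by_cases h : i = j
    · subst h; simp
    · simp [h]
  rw [this]; simp

lemma exists_dg {A : Matrix n n ℂ} (hA : A.IsHermitian) :
    ∃ (U : Matrix n n ℂ) (v : n → ℝ), Uᴴ * U = 1 ∧ A = dg U v ∧ v = hA.eigenvalues := by
  refine ⟨hA.eigenvectorUnitary, hA.eigenvalues, ?_, ?_, rfl⟩
  · exact Unitary.coe_star_mul_self hA.eigenvectorUnitary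
  · conv_lhs => rw [hA.spectral_theorem, Unitary.conjStarAlgAut_apply]
    rfl

lemma exists_dg_of_posSemidef {A : Matrix n n ℂ} (hA : A.PosSemidef) :
    ∃ (U : Matrix n n ℂ) (v : n → ℝ), Uᴴ * U = 1 ∧ A = dg U v ∧ ∀ i, 0 ≤ v i := by
  obtain ⟨U, v, hU, h, hv⟩ := exists_dg hA.1
  exact ⟨U, v, hU, h, fun i => hv ▸ hA.eigenvalues_nonneg i⟩

lemma matFun_dg {U : Matrix n n ℂ} (hU : Uᴴ * U = 1) (v : n → ℝ) (f : ℝ → ℝ) :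
    matFun f (dg U v) = dg U (fun i => f (v i)) := by
  have hA := dg_isHermitian U v
  set A := dg U v with hAdef
  have hUU : U * Uᴴ = 1 := mul_eq_one_comm.mp hU
  unfold matFun
  rw [dif_pos hA]
  set V : Matrix n n ℂ := (hA.eigenvectorUnitary : Matrix n n ℂ)
  have hV : Vᴴ * V = 1 := Unitary.coe_star_mul_self hA.eigenvectorUnitary
  have hVV : V * Vᴴ = 1 := mul_eq_one_comm.mp hV
  set e := hA.eigenvalues
  have hspec : A = V * diagonal (fun i => (e i : ℂ)) * Vᴴ := by
    conv_lhs => rw [hA.spectral_theorem, Unitary.conjStarAlgAut_apply]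
    rfl
  set S := Vᴴ * U with hS
  have h1 : diagonal (fun i => (e i : ℂ)) * S = S * diagonal (fun i => (v i : ℂ)) := by
    have h2 : Vᴴ * A * U = Vᴴ * A * U := rfl
    conv_lhs at h2 => rw [hspec]
    conv_rhs at h2 => rw [hAdef, dg]
    calc diagonal (fun i => (e i : ℂ)) * S
        = (Vᴴ * V) * diagonal (fun i => (e i : ℂ)) * Vᴴ * U := by
          rw [hV, Matrix.one_mul, hS, Matrix.mul_assoc]
      _ = Vᴴ * (V * diagonal (fun i => (e i : ℂ)) * Vᴴ) * U := by simp only [Matrix.mul_assoc]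
      _ = Vᴴ * (U * diagonal (fun i => (v i : ℂ)) * Uᴴ) * U := h2
      _ = S * diagonal (fun i => (v i : ℂ)) * (Uᴴ * U) := by simp only [hS, Matrix.mul_assoc]
      _ = _ := by rw [hU, Matrix.mul_one]
  have h3 : diagonal (fun i => (f (e i) : ℂ)) * S = S * diagonal (fun i => (f (v i) : ℂ)) := by
    ext i j
    have h4 := congrFun (congrFun h1 i) j
    rw [diagonal_mul, mul_diagonal] at h4 ⊢
    by_cases hs : S i j = 0
    · simp [hs]
    · have : (e i : ℂ) = v j := by
        apply mul_right_cancel₀ hs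
        rw [h4, mul_comm]
      have : e i = v j := by exact_mod_cast this
      rw [this, mul_comm]
  have h5 : V * S = U := by rw [hS, ← Matrix.mul_assoc, hVV, Matrix.one_mul]
  change V * diagonal (fun i => (f (e i) : ℂ)) * Vᴴ = _
  calc V * diagonal (fun i => (f (e i) : ℂ)) * Vᴴ
      = V * diagonal (fun i => (f (e i) : ℂ)) * Vᴴ * (U * Uᴴ) := by rw [hUU, Matrix.mul_one]
    _ = V * (diagonal (fun i => (f (e i) : ℂ)) * S) * Uᴴ := by simp only [hS, Matrix.mul_assoc]
    _ = (V * S) * diagonal (fun i => (f (v i) : ℂ)) * Uᴴ := by rw [h3]; simp only [Matrix.mul_assoc]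
    _ = dg U _ := by rw [h5]; rfl

lemma matFun_posSemidef {A : Matrix n n ℂ} (hA : A.PosSemidef) {f : ℝ → ℝ}
    (hf : ∀ x, 0 ≤ x → 0 ≤ f x) : (matFun f A).PosSemidef := by
  obtain ⟨U, v, hU, rfl, hv⟩ := exists_dg_of_posSemidef hA
  rw [matFun_dg hU]
  exact dg_posSemidef U fun i => hf _ (hv i)

lemma matFun_sqrt_mul_self {A : Matrix n n ℂ} (hA : A.PosSemidef) :
    matFun Real.sqrt A * matFun Real.sqrt A = A := by
  obtain ⟨U, v, hU, rfl, hv⟩ := exists_dg_of_posSemidef hA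
  rw [matFun_dg hU, dg_mul hU]
  congr 1
  ext i
  exact Real.mul_self_sqrt (hv i)

lemma matFun_sqrt_unique {A B : Matrix n n ℂ} (hB : B.PosSemidef) (h : B * B = A) :
    matFun Real.sqrt A = B := by
  obtain ⟨U, v, hU, rfl, hv⟩ := exists_dg_of_posSemidef hB
  rw [← h, dg_mul hU, matFun_dg hU]
  congr 1
  ext i
  exact Real.sqrt_mul_self (hv i)

lemma trace_matFun {A : Matrix n n ℂ} (hA : A.IsHermitian) (f : ℝ → ℝ) :
    (matFun f A).trace.re = ∑ i, f (hA.eigenvalues i) := by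
  obtain ⟨U, v, hU, h, hv⟩ := exists_dg hA
  rw [← hv, h, matFun_dg hU, dg_trace_re hU]

lemma trace_matFun_mul_comm {A B : Matrix n n ℂ} (h1 : (A * B).IsHermitian)
    (h2 : (B * A).IsHermitian) (f : ℝ → ℝ) :
    (matFun f (A * B)).trace.re = (matFun f (B * A)).trace.re := by
  rw [trace_matFun h1, trace_matFun h2]
  have h := congrArg Polynomial.roots (charpoly_mul_comm A B)
  rw [h1.roots_charpoly_eq_eigenvalues, h2.roots_charpoly_eq_eigenvalues] at h
  have h' := congrArg (fun s => (Multiset.map (fun z : ℂ => f z.re) s).sum) h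
  simpa [Multiset.map_map, Function.comp_def] using h'

lemma trace_mul_re_nonneg {A B : Matrix n n ℂ} (hA : A.PosSemidef) (hB : B.PosSemidef) :
    0 ≤ (A * B).trace.re := by
  have h : (matFun Real.sqrt B * A * matFun Real.sqrt B).PosSemidef := by
    have := hA.mul_mul_conjTranspose_same (matFun Real.sqrt B)
    rwa [(matFun_posSemidef hB fun x _ => Real.sqrt_nonneg x).1.eq] at this
  have h2 := h.trace_nonneg
  rw [Matrix.mul_assoc, Matrix.trace_mul_comm, Matrix.mul_assoc, matFun_sqrt_mul_self hB] at h2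
  exact (Complex.le_def.mp h2).1

/-- The diagonal entries of `dg Q b` in the basis given by `V`. -/
lemma conj_dg_diag (V Q : Matrix n n ℂ) (b : n → ℝ) (i : n) :
    ((Vᴴ * dg Q b * V) i i).re = ∑ k, Complex.normSq ((Qᴴ * V) k i) * b k := by
  have h : Vᴴ * dg Q b * V = (Qᴴ * V)ᴴ * diagonal (fun i => (b i : ℂ)) * (Qᴴ * V) := by
    unfold dg
    simp only [conjTranspose_mul, conjTranspose_conjTranspose, Matrix.mul_assoc]
  rw [h, Matrix.mul_apply, Complex.re_sum]
  refine Finset.sum_congr rfl fun k _ => ?_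
  rw [mul_diagonal, conjTranspose_apply]
  simp only [Complex.star_def, Complex.normSq_apply, Complex.mul_re, Complex.mul_im,
    Complex.conj_re, Complex.conj_im, Complex.ofReal_re, Complex.ofReal_im]
  ring

lemma sum_normSq_col {S : Matrix n n ℂ} (hS : Sᴴ * S = 1) (i : n) :
    ∑ k, Complex.normSq (S k i) = 1 := by
  have h := congrArg Complex.re (congrFun (congrFun hS i) i)
  rw [Matrix.mul_apply, Complex.re_sum] at h
  simp only [one_apply_eq, Complex.one_re] at h
  rw [← h]
  refine Finset.sum_congr rfl fun k _ => ?_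
  simp [conjTranspose_apply, Complex.normSq_apply]

lemma sum_normSq_row {S : Matrix n n ℂ} (hS : S * Sᴴ = 1) (k : n) :
    ∑ i, Complex.normSq (S k i) = 1 := by
  have h := sum_normSq_col (S := Sᴴ) (by rwa [conjTranspose_conjTranspose]) k
  rw [← h]
  refine Finset.sum_congr rfl fun k _ => ?_
  simp [conjTranspose_apply, Complex.normSq_conj]

lemma unitary_conj_mul {Q V : Matrix n n ℂ} (hQ : Qᴴ * Q = 1) (hV : Vᴴ * V = 1) :
    (Qᴴ * V)ᴴ * (Qᴴ * V) = 1 := by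
  have hQQ : Q * Qᴴ = 1 := mul_eq_one_comm.mp hQ
  rw [conjTranspose_mul, conjTranspose_conjTranspose]
  calc Vᴴ * Q * (Qᴴ * V) = Vᴴ * (Q * Qᴴ) * V := by simp only [Matrix.mul_assoc]
    _ = 1 := by rw [hQQ, Matrix.mul_one, hV]

lemma trace_mul_dg (B V : Matrix n n ℂ) (r : n → ℝ) :
    (B * dg V r).trace.re = ∑ i, r i * ((Vᴴ * B * V) i i).re := by
  have : (B * dg V r).trace = ((Vᴴ * B * V) * diagonal (fun i => (r i : ℂ))).trace := by
    unfold dg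
    rw [← Matrix.mul_assoc, Matrix.trace_mul_comm]
    simp only [Matrix.mul_assoc]
  rw [this, trace, Complex.re_sum]
  refine Finset.sum_congr rfl fun i _ => ?_
  rw [diag_apply, mul_diagonal]
  simp [mul_comm]

end

section

variable {n : Type*} [Fintype n] [DecidableEq n]

lemma trace_mul_conjTranspose_re (X : Matrix n n ℂ) :
    (X * Xᴴ).trace.re = ∑ p : n × n, ‖X p.1 p.2‖ ^ 2 := by
  rw [Fintype.sum_prod_type, trace, Complex.re_sum]
  refine Finset.sum_congr rfl fun i _ => ?_
  rw [diag_apply, Matrix.mul_apply, Complex.re_sum]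
  refine Finset.sum_congr rfl fun j _ => ?_
  rw [conjTranspose_apply, ← Complex.normSq_eq_norm_sq]
  simp [Complex.normSq_apply]

lemma trace_mul_re_sq_le (X Y : Matrix n n ℂ) :
    (X * Y).trace.re ^ 2 ≤ (X * Xᴴ).trace.re * (Yᴴ * Y).trace.re := by
  have hY : (Yᴴ * Y).trace.re = ∑ p : n × n, ‖Y p.2 p.1‖ ^ 2 := by
    rw [Matrix.trace_mul_comm, trace_mul_conjTranspose_re]
    exact (Equiv.sum_comp (Equiv.prodComm n n) fun p : n × n => ‖Y p.1 p.2‖ ^ 2).symm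
  have h : |(X * Y).trace.re| ≤ ∑ p : n × n, ‖X p.1 p.2‖ * ‖Y p.2 p.1‖ := by
    refine (Complex.abs_re_le_norm _).trans ?_
    rw [Fintype.sum_prod_type, trace]
    refine (norm_sum_le _ _).trans (Finset.sum_le_sum fun i _ => ?_)
    rw [diag_apply, Matrix.mul_apply]
    refine (norm_sum_le _ _).trans (Finset.sum_le_sum fun j _ => ?_)
    rw [norm_mul]
  rw [hY, trace_mul_conjTranspose_re, ← sq_abs]
  exact (pow_le_pow_left₀ (abs_nonneg _) h 2).trans (Finset.sum_mul_sq_le_sq_mul_sq _ _ _)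

lemma diag_re_le_one_of_idem {E : Matrix n n ℂ} (hE : Eᴴ = E) (hEE : E * E = E) (i : n) :
    (E i i).re ≤ 1 := by
  have h : (E i i).re = ∑ j, Complex.normSq (E i j) := by
    conv_lhs => rw [← hEE]
    rw [Matrix.mul_apply, Complex.re_sum]
    refine Finset.sum_congr rfl fun j _ => ?_
    have : E j i = star (E i j) := by rw [← conjTranspose_apply, hE]
    rw [this]
    simp [Complex.normSq_apply]
  have h2 : (E i i).re ^ 2 ≤ (E i i).re := by
    calc (E i i).re ^ 2 ≤ Complex.normSq (E i i) := by
          rw [Complex.normSq_apply]; nlinarith [sq_nonneg (E i i).im]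
      _ ≤ ∑ j, Complex.normSq (E i j) :=
          Finset.single_le_sum (f := fun j => Complex.normSq (E i j))
            (fun j _ => Complex.normSq_nonneg _) (Finset.mem_univ i)
      _ = _ := h.symm
  nlinarith

lemma conj_idem {U E : Matrix n n ℂ} (hU : Uᴴ * U = 1) (hE : Eᴴ = E) (hEE : E * E = E) :
    (Uᴴ * E * U)ᴴ = Uᴴ * E * U ∧ (Uᴴ * E * U) * (Uᴴ * E * U) = Uᴴ * E * U := by
  have hUU : U * Uᴴ = 1 := mul_eq_one_comm.mp hU
  constructor
  · simp only [conjTranspose_mul, conjTranspose_conjTranspose, hE, Matrix.mul_assoc]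
  · calc Uᴴ * E * U * (Uᴴ * E * U) = Uᴴ * (E * (U * Uᴴ) * E) * U := by
          simp only [Matrix.mul_assoc]
      _ = _ := by rw [hUU, Matrix.mul_one, hEE]

/-- Trace Hölder inequality for a partial isometry between two density matrices. -/
lemma trace_partial_isometry_le {U V P : Matrix n n ℂ} (hU : Uᴴ * U = 1) (hV : Vᴴ * V = 1)
    (hP1 : Pᴴ * P * (Pᴴ * P) = Pᴴ * P) (hP2 : P * Pᴴ * (P * Pᴴ) = P * Pᴴ)
    {a w : n → ℝ} (ha : ∀ i, 0 ≤ a i) (hw : ∀ i, 0 ≤ w i) (ha1 : ∑ i, a i = 1)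
    (hw1 : ∑ i, w i = 1) {t : ℝ} (ht0 : 0 ≤ t) (ht1 : t ≤ 1) :
    (dg U (fun i => a i ^ (1 - t)) * P * dg V (fun i => w i ^ t) * Pᴴ).trace.re ≤ 1 := by
  set S := Uᴴ * P * V with hS
  have hUU : U * Uᴴ = 1 := mul_eq_one_comm.mp hU
  have hVV : V * Vᴴ = 1 := mul_eq_one_comm.mp hV
  have key : (dg U (fun i => a i ^ (1 - t)) * P * dg V (fun i => w i ^ t) * Pᴴ).trace.re
      = ∑ i, ∑ j, Complex.normSq (S i j) * (a i ^ (1 - t) * w j ^ t) := by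
    rw [Matrix.mul_assoc, Matrix.mul_assoc, Matrix.trace_mul_comm, trace_mul_dg]
    refine Finset.sum_congr rfl fun i _ => ?_
    have h : Uᴴ * (P * (dg V (fun i => w i ^ t) * Pᴴ)) * U
        = S * diagonal (fun i => ((w i ^ t : ℝ) : ℂ)) * Sᴴ := by
      simp only [dg, hS, conjTranspose_mul, conjTranspose_conjTranspose, Matrix.mul_assoc]
    rw [h, Matrix.mul_apply, Complex.re_sum, Finset.mul_sum]
    refine Finset.sum_congr rfl fun k _ => ?_
    rw [mul_diagonal, conjTranspose_apply]
    simp only [Complex.star_def, Complex.normSq_apply, Complex.mul_re, Complex.mul_im,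
      Complex.conj_re, Complex.conj_im, Complex.ofReal_re, Complex.ofReal_im]
    ring
  have hrow : ∀ i, ∑ j, Complex.normSq (S i j) ≤ 1 := by
    intro i
    have e := conj_idem hU (E := P * Pᴴ) (by simp) hP2
    have h := diag_re_le_one_of_idem e.1 e.2 i
    have h2 : Uᴴ * (P * Pᴴ) * U = S * Sᴴ := by
      rw [hS]
      simp only [conjTranspose_mul, conjTranspose_conjTranspose]
      calc Uᴴ * (P * Pᴴ) * U = Uᴴ * (P * 1 * Pᴴ) * U := by rw [Matrix.mul_one]
        _ = _ := by rw [← hVV]; simp only [Matrix.mul_assoc]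
    rw [h2, Matrix.mul_apply, Complex.re_sum] at h
    refine le_of_eq_of_le (Finset.sum_congr rfl fun j _ => ?_) h
    simp [conjTranspose_apply, Complex.normSq_apply]
  have hcol : ∀ j, ∑ i, Complex.normSq (S i j) ≤ 1 := by
    intro j
    have e := conj_idem hV (E := Pᴴ * P) (by simp) hP1
    have h := diag_re_le_one_of_idem e.1 e.2 j
    have h2 : Vᴴ * (Pᴴ * P) * V = Sᴴ * S := by
      rw [hS]
      simp only [conjTranspose_mul, conjTranspose_conjTranspose]
      calc Vᴴ * (Pᴴ * P) * V = Vᴴ * (Pᴴ * 1 * P) * V := by rw [Matrix.mul_one]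
        _ = _ := by rw [← hUU]; simp only [Matrix.mul_assoc]
    rw [h2, Matrix.mul_apply, Complex.re_sum] at h
    refine le_of_eq_of_le (Finset.sum_congr rfl fun i _ => ?_) h
    simp [conjTranspose_apply, Complex.normSq_apply]
  rw [key]
  calc ∑ i, ∑ j, Complex.normSq (S i j) * (a i ^ (1 - t) * w j ^ t)
      ≤ ∑ i, ∑ j, Complex.normSq (S i j) * ((1 - t) * a i + t * w j) := by
        refine Finset.sum_le_sum fun i _ => Finset.sum_le_sum fun j _ => ?_
        refine mul_le_mul_of_nonneg_left ?_ (Complex.normSq_nonneg _)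
        exact Real.geom_mean_le_arith_mean2_weighted (by linarith) ht0 (ha i) (hw j) (by ring)
    _ = (1 - t) * ∑ i, a i * ∑ j, Complex.normSq (S i j)
        + t * ∑ j, w j * ∑ i, Complex.normSq (S i j) := by
        simp only [mul_add, Finset.sum_add_distrib, Finset.mul_sum]
        congr 1
        · refine Finset.sum_congr rfl fun i _ => Finset.sum_congr rfl fun j _ => by ring
        · rw [Finset.sum_comm]
          refine Finset.sum_congr rfl fun i _ => Finset.sum_congr rfl fun j _ => by ring
    _ ≤ (1 - t) * ∑ i, a i * 1 + t * ∑ j, w j * 1 := by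
        refine add_le_add (mul_le_mul_of_nonneg_left ?_ (by linarith))
          (mul_le_mul_of_nonneg_left ?_ ht0)
        · exact Finset.sum_le_sum fun i _ => mul_le_mul_of_nonneg_left (hrow i) (ha i)
        · exact Finset.sum_le_sum fun j _ => mul_le_mul_of_nonneg_left (hcol j) (hw j)
    _ = 1 := by simp [ha1, hw1]

/-- Bound on the fidelity through a full-rank auxiliary density matrix `V diag(w) Vᴴ`. -/
lemma qFid_le {ρ U V : Matrix n n ℂ} (hρ : ρ.PosSemidef) (hU : Uᴴ * U = 1) (hV : Vᴴ * V = 1)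
    {a w : n → ℝ} (ha : ∀ i, 0 ≤ a i) (hw : ∀ i, 0 < w i) (ha1 : ∑ i, a i = 1)
    (hw1 : ∑ i, w i = 1) {t : ℝ} (ht0 : 0 < t) (ht1 : t ≤ 1) :
    qFid ρ (dg U a) ≤ (matFun Real.sqrt ρ * dg V (fun i => w i ^ (-t)) * matFun Real.sqrt ρ *
      dg U (fun i => a i ^ t)).trace.re := by
  have hSherm : (matFun Real.sqrt ρ)ᴴ = matFun Real.sqrt ρ :=
    (matFun_posSemidef hρ fun x _ => Real.sqrt_nonneg x).1
  unfold qFid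
  set S := matFun Real.sqrt ρ with hS
  set T1 := dg U (fun i => a i ^ (t / 2)) with hT1
  set T2 := dg U (fun i => a i ^ ((1 - t) / 2)) with hT2
  have hT1h : T1ᴴ = T1 := dg_isHermitian _ _
  have hT2h : T2ᴴ = T2 := dg_isHermitian _ _
  set C := T2 * T1 * S with hC
  have hTT : T1 * T2 * (T2 * T1) = dg U a := by
    rw [hT1, hT2, dg_mul hU, dg_mul hU, dg_mul hU]
    congr 1
    ext i
    rcases (ha i).eq_or_lt with h | h
    · rw [← h, Real.zero_rpow (by positivity)]; ring
    · rw [← Real.rpow_add h, ← Real.rpow_add h, ← Real.rpow_add h]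
      ring_nf
      simp
  have hCC : S * dg U a * S = Cᴴ * C := by
    rw [← hTT, hC]
    simp only [conjTranspose_mul, hSherm, hT1h, hT2h, Matrix.mul_assoc]
  have hpsd : (Cᴴ * C).PosSemidef := posSemidef_conjTranspose_mul_self C
  obtain ⟨Q, p2, hQ, hp2, hp2n⟩ := exists_dg_of_posSemidef hpsd
  have hQQ : Q * Qᴴ = 1 := mul_eq_one_comm.mp hQ
  set D := dg Q (fun i => (Real.sqrt (p2 i))⁻¹) with hD
  have hDh : Dᴴ = D := dg_isHermitian _ _
  set P := C * D with hP
  have hPP : Pᴴ * P = dg Q (fun i => if p2 i = 0 then 0 else 1) := by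
    calc Pᴴ * P = D * (Cᴴ * C) * D := by
          rw [hP, conjTranspose_mul, hDh]; simp only [Matrix.mul_assoc]
      _ = _ := by
          rw [hp2, hD, dg_mul hQ, dg_mul hQ]
          congr 1
          ext i
          by_cases h : p2 i = 0
          · simp [h]
          · have h' : 0 < p2 i := lt_of_le_of_ne (hp2n i) (Ne.symm h)
            have h'' := Real.sqrt_pos.mpr h'
            rw [if_neg h]
            nth_rewrite 2 [← Real.mul_self_sqrt h'.le]
            field_simp
  have hP1 : Pᴴ * P * (Pᴴ * P) = Pᴴ * P := by
    rw [hPP, dg_mul hQ]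
    congr 1
    ext i
    split_ifs <;> simp
  have hDI : D * dg Q (fun i => if p2 i = 0 then 0 else 1) = D := by
    rw [hD, dg_mul hQ]
    congr 1
    ext i
    split_ifs with h <;> simp [h]
  have hP2 : P * Pᴴ * (P * Pᴴ) = P * Pᴴ := by
    calc P * Pᴴ * (P * Pᴴ) = P * (Pᴴ * P) * Pᴴ := by simp only [Matrix.mul_assoc]
      _ = _ := by rw [hPP, hP, Matrix.mul_assoc C, hDI]
  have hsq : matFun Real.sqrt (Cᴴ * C) = Pᴴ * C := by
    rw [hp2, matFun_dg hQ, hP, conjTranspose_mul, hDh, Matrix.mul_assoc, hp2, hD, dg_mul hQ]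
    congr 1
    ext i
    rw [← div_eq_inv_mul, Real.div_sqrt]
  rw [hCC, hsq]
  set X := T1 * S * dg V (fun i => w i ^ (-t / 2)) with hX
  set Y := dg V (fun i => w i ^ (t / 2)) * Pᴴ * T2 with hY
  have hZ : dg V (fun i => w i ^ (-t / 2)) * dg V (fun i => w i ^ (t / 2)) = 1 := by
    rw [dg_mul hV]
    have : (fun i => w i ^ (-t / 2) * w i ^ (t / 2)) = fun _ => 1 := by
      ext i
      rw [← Real.rpow_add (hw i)]
      ring_nf
      simp
    rw [this, dg]
    simp [mul_eq_one_comm.mp hV]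
  have hXY : (Pᴴ * C).trace = (X * Y).trace := by
    have : X * Y = T1 * S * Pᴴ * T2 := by
      calc X * Y = T1 * S * (dg V (fun i => w i ^ (-t / 2)) * dg V (fun i => w i ^ (t / 2)))
            * Pᴴ * T2 := by simp only [hX, hY, Matrix.mul_assoc]
        _ = _ := by rw [hZ, Matrix.mul_one]
    calc (Pᴴ * C).trace = ((Pᴴ * T2) * (T1 * S)).trace := by
          rw [hC]; simp only [Matrix.mul_assoc]
      _ = ((T1 * S) * (Pᴴ * T2)).trace := Matrix.trace_mul_comm _ _
      _ = _ := by rw [this]; simp only [Matrix.mul_assoc]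
  rw [hXY]
  refine (trace_mul_re_sq_le X Y).trans ?_
  have hX1 : (X * Xᴴ).trace = (S * dg V (fun i => w i ^ (-t)) * S *
      dg U (fun i => a i ^ t)).trace := by
    have e1 : dg V (fun i => w i ^ (-t)) =
        dg V (fun i => w i ^ (-t / 2)) * dg V (fun i => w i ^ (-t / 2)) := by
      rw [dg_mul hV]
      congr 1
      ext i
      rw [← Real.rpow_add (hw i)]
      ring_nf
    have e2 : dg U (fun i => a i ^ t) = T1 * T1 := by
      rw [hT1, dg_mul hU]
      congr 1
      ext i
      rw [← Real.rpow_add_of_nonneg (ha i) (by positivity) (by positivity)]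
      ring_nf
    rw [e1, e2, ← Matrix.mul_assoc _ T1 T1, Matrix.trace_mul_comm _ T1, hX]
    simp only [conjTranspose_mul, hSherm, hT1h, (dg_isHermitian V _).eq, Matrix.mul_assoc]
  have hY1 : (Yᴴ * Y).trace.re ≤ 1 := by
    have e1 : dg V (fun i => w i ^ t) =
        dg V (fun i => w i ^ (t / 2)) * dg V (fun i => w i ^ (t / 2)) := by
      rw [dg_mul hV]
      congr 1
      ext i
      rw [← Real.rpow_add (hw i)]
      ring_nf
    have e2 : dg U (fun i => a i ^ (1 - t)) = T2 * T2 := by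
      rw [hT2, dg_mul hU]
      congr 1
      ext i
      rw [← Real.rpow_add_of_nonneg (ha i) (by linarith) (by linarith)]
      ring_nf
    have h := trace_partial_isometry_le hU hV hP1 hP2 ha (fun i => (hw i).le) ha1 hw1 ht0.le ht1
    rw [e1, e2] at h
    have e3 : (Yᴴ * Y).trace = (T2 * T2 * P *
        (dg V (fun i => w i ^ (t / 2)) * dg V (fun i => w i ^ (t / 2))) * Pᴴ).trace := by
      rw [Matrix.mul_assoc T2 T2, Matrix.mul_assoc T2 _ _, Matrix.mul_assoc T2 _ _,
        Matrix.trace_mul_comm T2, hY]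
      simp only [conjTranspose_mul, conjTranspose_conjTranspose, hT2h, (dg_isHermitian V _).eq,
        Matrix.mul_assoc]
    rw [e3]
    exact h
  have hX0 : 0 ≤ (X * Xᴴ).trace.re := by
    rw [trace_mul_conjTranspose_re]; positivity
  calc (X * Xᴴ).trace.re * (Yᴴ * Y).trace.re ≤ (X * Xᴴ).trace.re * 1 := by gcongr
    _ = _ := by rw [mul_one, hX1]

lemma matFun_eq_cfc {A : Matrix n n ℂ} (hA : A.IsHermitian) (f : ℝ → ℝ) :
    matFun f A = cfc f A := by
  rw [hA.cfc_eq, matFun, dif_pos hA, Matrix.IsHermitian.cfc, Unitary.conjStarAlgAut_apply]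
  rfl

open scoped MatrixOrder Matrix.Norms.L2Operator in
/-- The Löwner–Heinz inequality for matrices. -/
lemma matFun_rpow_mono {A B : Matrix n n ℂ} (hA : A.PosSemidef) (hAB : (B - A).PosSemidef)
    {t : ℝ} (ht0 : 0 ≤ t) (ht1 : t ≤ 1) :
    (matFun (fun x => x ^ t) B - matFun (fun x => x ^ t) A).PosSemidef := by
  have hB : B.PosSemidef := by simpa using hAB.add hA
  rw [matFun_eq_cfc hB.1, matFun_eq_cfc hA.1, ← CFC.rpow_eq_cfc_real (a := B) (ha := hB.nonneg),
    ← CFC.rpow_eq_cfc_real (a := A) (ha := hA.nonneg)]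
  exact CFC.rpow_le_rpow (A := Matrix n n ℂ) ⟨ht0, ht1⟩ (a := A) (b := B) hAB

end

section

variable {B : Type*} [Fintype B] [DecidableEq B] {k : ℕ}

lemma tensProd_mul (V W : Fin k → Matrix B B ℂ) :
    tensProd V * tensProd W = tensProd (fun i => V i * W i) := by
  ext a b
  simp only [tensProd, Matrix.mul_apply, Matrix.of_apply]
  rw [Finset.prod_univ_sum, Fintype.piFinset_univ]
  simp only [Finset.prod_mul_distrib]

lemma tensProd_conjTranspose (V : Fin k → Matrix B B ℂ) :
    (tensProd V)ᴴ = tensProd (fun i => (V i)ᴴ) := by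
  ext a b
  simp [tensProd, conjTranspose_apply]

lemma tensProd_diagonal (v : Fin k → B → ℂ) :
    tensProd (fun i => diagonal (v i)) = diagonal (fun a : Fin k → B => ∏ i, v i (a i)) := by
  ext a b
  simp only [tensProd, Matrix.of_apply]
  by_cases h : a = b
  · subst h; simp
  · rw [diagonal_apply_ne _ h]
    obtain ⟨i, hi⟩ := Function.ne_iff.mp h
    exact Finset.prod_eq_zero (Finset.mem_univ i) (diagonal_apply_ne _ hi)

lemma tensProd_one : tensProd (fun _ : Fin k => (1 : Matrix B B ℂ)) = 1 := by
  have h := tensProd_diagonal (k := k) (fun _ (_ : B) => (1 : ℂ))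
  simpa using h

lemma tensProd_dg (U : Fin k → Matrix B B ℂ) (v : Fin k → B → ℝ) :
    tensProd (fun i => dg (U i) (v i)) = dg (tensProd U) (fun a => ∏ i, v i (a i)) := by
  unfold dg
  rw [← tensProd_mul, ← tensProd_mul, ← tensProd_conjTranspose, tensProd_diagonal]
  simp

lemma tensProd_unitary {U : Fin k → Matrix B B ℂ} (hU : ∀ i, (U i)ᴴ * U i = 1) :
    (tensProd U)ᴴ * tensProd U = 1 := by
  rw [tensProd_conjTranspose, tensProd_mul]
  simp only [hU, tensProd_one]

lemma tensProd_posSemidef {V : Fin k → Matrix B B ℂ} (hV : ∀ i, (V i).PosSemidef) :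
    (tensProd V).PosSemidef := by
  choose U v hU h hv using fun i => exists_dg_of_posSemidef (hV i)
  rw [funext h, tensProd_dg]
  exact dg_posSemidef _ fun a => Finset.prod_nonneg fun i _ => hv i _

lemma tensProd_trace (V : Fin k → Matrix B B ℂ) :
    (tensProd V).trace = ∏ i, (V i).trace := by
  simp only [trace, diag_apply, tensProd, Matrix.of_apply]
  rw [Finset.prod_univ_sum, Fintype.piFinset_univ]

lemma tensProd_density {V : Fin k → Matrix B B ℂ} (hV : ∀ i, IsDensity (V i)) :
    IsDensity (tensProd V) := by
  refine ⟨tensProd_posSemidef fun i => (hV i).1, ?_⟩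
  rw [tensProd_trace]
  exact Finset.prod_eq_one fun i _ => (hV i).2

lemma matFun_sqrt_tensProd {V : Fin k → Matrix B B ℂ} (hV : ∀ i, (V i).PosSemidef) :
    matFun Real.sqrt (tensProd V) = tensProd (fun i => matFun Real.sqrt (V i)) := by
  apply matFun_sqrt_unique
  · exact tensProd_posSemidef fun i => matFun_posSemidef (hV i) fun x _ => Real.sqrt_nonneg x
  · rw [tensProd_mul]
    simp only [matFun_sqrt_mul_self (hV _)]

lemma sum_smul_tensProd {J : Type*} [Fintype J] (p : J → ℝ) (R : J → Matrix B B ℂ) :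
    ∑ js : Fin k → J, (∏ i, p (js i)) • tensProd (fun i => R (js i))
      = tensProd (fun _ : Fin k => ∑ j, p j • R j) := by
  ext a b
  simp only [tensProd, Matrix.sum_apply, Matrix.smul_apply, Matrix.of_apply, Complex.real_smul]
  rw [Finset.prod_univ_sum, Fintype.piFinset_univ]
  refine Finset.sum_congr rfl fun js _ => ?_
  rw [Finset.prod_mul_distrib]
  push_cast
  rfl

lemma sum_prod_rpow_le {r : B → ℝ} {t N : ℝ} (hN0 : 0 ≤ N) (hr : ∀ i, 0 ≤ r i)
    (h : ∀ P : B → ℝ, (∀ i, 0 ≤ P i) → ∑ i, r i * P i ^ t ≤ N * (∑ i, P i) ^ t) (m : ℕ)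
    (P : (Fin m → B) → ℝ) (hP : ∀ a, 0 ≤ P a) :
    ∑ a, (∏ i, r (a i)) * P a ^ t ≤ N ^ m * (∑ a, P a) ^ t := by
  induction m with
  | zero => simp
  | succ m ih =>
    have e : ∀ f : (Fin (m + 1) → B) → ℝ, ∑ a, f a = ∑ b : B, ∑ a : Fin m → B, f (Fin.cons b a) := by
      intro f
      rw [← Fintype.sum_prod_type']
      exact ((Fin.consEquiv fun _ => B).sum_comp f).symm
    rw [e, e]
    calc ∑ b : B, ∑ a : Fin m → B, (∏ i, r ((Fin.cons b a : Fin (m + 1) → B) i)) *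
          P (Fin.cons b a) ^ t
        = ∑ b : B, r b * ∑ a : Fin m → B, (∏ i, r (a i)) * P (Fin.cons b a) ^ t := by
          refine Finset.sum_congr rfl fun b _ => ?_
          rw [Finset.mul_sum]
          refine Finset.sum_congr rfl fun a _ => ?_
          rw [Fin.prod_univ_succ]
          simp [mul_assoc]
      _ ≤ ∑ b : B, r b * (N ^ m * (∑ a : Fin m → B, P (Fin.cons b a)) ^ t) := by
          refine Finset.sum_le_sum fun b _ => mul_le_mul_of_nonneg_left ?_ (hr b)
          exact ih (fun a => P (Fin.cons b a)) fun a => hP _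
      _ = N ^ m * ∑ b : B, r b * (∑ a : Fin m → B, P (Fin.cons b a)) ^ t := by
          rw [Finset.mul_sum]
          refine Finset.sum_congr rfl fun b _ => by ring
      _ ≤ N ^ m * (N * (∑ b : B, ∑ a : Fin m → B, P (Fin.cons b a)) ^ t) := by
          refine mul_le_mul_of_nonneg_left ?_ (pow_nonneg hN0 m)
          exact h _ fun b => Finset.sum_nonneg fun a _ => hP _
      _ = _ := by ring

/-- Positive semidefinite matrices of Schatten `q`-norm at most one, expressed through the
diagonals in all orthonormal bases. -/
def schattenBall (B : Type*) [Fintype B] [DecidableEq B] (q : ℝ) : Set (Matrix B B ℂ) :=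
  {Y | Y.PosSemidef ∧ ∀ U : Matrix B B ℂ, Uᴴ * U = 1 → ∑ i, ((Uᴴ * Y * U) i i).re ^ q ≤ 1}

lemma dg_mem_schattenBall {V : Matrix B B ℂ} (hV : Vᴴ * V = 1) {y : B → ℝ} (hy : ∀ i, 0 ≤ y i)
    {q : ℝ} (hq : 1 ≤ q) (hy1 : ∑ i, y i ^ q ≤ 1) : dg V y ∈ schattenBall B q := by
  refine ⟨dg_posSemidef V hy, fun U hU => ?_⟩
  have hS := unitary_conj_mul hV hU
  have hS' := mul_eq_one_comm.mp hS
  set S := Vᴴ * U with hSdef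
  calc ∑ i, ((Uᴴ * dg V y * U) i i).re ^ q
      = ∑ i, (∑ j, Complex.normSq (S j i) * y j) ^ q := by
        simp only [conj_dg_diag, ← hSdef]
    _ ≤ ∑ i, ∑ j, Complex.normSq (S j i) * y j ^ q := by
        refine Finset.sum_le_sum fun i _ => ?_
        exact Real.rpow_arith_mean_le_arith_mean_rpow Finset.univ _ _
          (fun j _ => Complex.normSq_nonneg _) (sum_normSq_col hS i) (fun j _ => hy j) hq
    _ = ∑ j, y j ^ q := by
        rw [Finset.sum_comm]
        refine Finset.sum_congr rfl fun j _ => ?_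
        rw [← Finset.sum_mul, sum_normSq_row hS' j, one_mul]
    _ ≤ 1 := hy1

lemma sum_rpow_le_of_schattenBall {V : Matrix B B ℂ} (hV : Vᴴ * V = 1) {r : B → ℝ} {t c : ℝ}
    (ht0 : 0 < t) (ht1 : t ≤ 1)
    (h : ∀ Y ∈ schattenBall B t⁻¹, (Y * dg V r).trace.re ≤ c) (P : B → ℝ) (hP : ∀ i, 0 ≤ P i) :
    ∑ i, r i * P i ^ t ≤ c * (∑ i, P i) ^ t := by
  obtain ⟨s, hs⟩ : ∃ s, s = ∑ i, P i := ⟨_, rfl⟩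
  rw [← hs]
  have hs0 : 0 ≤ s := hs ▸ Finset.sum_nonneg fun i _ => hP i
  rcases hs0.eq_or_lt with h0 | h0
  · have hz : ∀ i, P i = 0 := fun i =>
      (Finset.sum_eq_zero_iff_of_nonneg fun i _ => hP i).mp (hs ▸ h0.symm) i (Finset.mem_univ i)
    rw [← h0]
    simp [hz, Real.zero_rpow ht0.ne']
  · have hy : ∀ i, 0 ≤ (P i / s) ^ t := fun i => Real.rpow_nonneg (div_nonneg (hP i) h0.le) t
    have hmem := dg_mem_schattenBall hV hy (one_le_inv₀ ht0 |>.mpr ht1) (by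
      have : ∀ i, ((P i / s) ^ t) ^ t⁻¹ = P i / s := fun i =>
        Real.rpow_rpow_inv (div_nonneg (hP i) h0.le) ht0.ne'
      simp only [this]
      rw [← Finset.sum_div, ← hs, div_self h0.ne'])
    have h2 := h _ hmem
    rw [Matrix.trace_mul_comm, Matrix.trace_mul_comm, dg_mul hV, dg_trace_re hV] at h2
    calc ∑ i, r i * P i ^ t = (∑ i, (P i / s) ^ t * r i) * s ^ t := by
          rw [Finset.sum_mul]
          refine Finset.sum_congr rfl fun i _ => ?_
          rw [Real.div_rpow (hP i) h0.le]
          field_simp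
      _ ≤ c * s ^ t := by gcongr

lemma conj_dg_rpow_diag_le {V Q : Matrix B B ℂ} (hV : Vᴴ * V = 1) (hQ : Qᴴ * Q = 1) {b : B → ℝ}
    (hb : ∀ i, 0 ≤ b i) {t : ℝ} (ht0 : 0 ≤ t) (ht1 : t ≤ 1) (i : B) :
    ((Vᴴ * dg Q (fun k => b k ^ t) * V) i i).re ≤ ((Vᴴ * dg Q b * V) i i).re ^ t := by
  rw [conj_dg_diag, conj_dg_diag]
  have h := (Real.concaveOn_rpow ht0 ht1).le_map_sum (t := Finset.univ)
    (w := fun k => Complex.normSq ((Qᴴ * V) k i)) (p := b)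
    (fun k _ => Complex.normSq_nonneg _) (sum_normSq_col (unitary_conj_mul hQ hV) i)
    (fun k _ => hb k)
  simpa using h

lemma sum_conj_diag {V : Matrix B B ℂ} (hV : Vᴴ * V = 1) (A : Matrix B B ℂ) :
    ∑ i, ((Vᴴ * A * V) i i).re = A.trace.re := by
  have : (Vᴴ * A * V).trace = A.trace := by
    rw [Matrix.trace_mul_comm, ← Matrix.mul_assoc, mul_eq_one_comm.mp hV, Matrix.one_mul]
  rw [← this, trace, Complex.re_sum]
  rfl

/-- Multiplicativity of the dual bound. -/
lemma trace_tensProd_le {R : Matrix B B ℂ} (hR : R.PosSemidef) {t c : ℝ} (hc : 0 ≤ c)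
    (ht0 : 0 < t) (ht1 : t ≤ 1) (h : ∀ Y ∈ schattenBall B t⁻¹, (Y * R).trace.re ≤ c)
    {τ : Matrix (Fin k → B) (Fin k → B) ℂ} (hτ : IsDensity τ) :
    (matFun (fun x => x ^ t) τ * tensProd (fun _ => R)).trace.re ≤ c ^ k := by
  obtain ⟨V, r, hV, rfl, hr⟩ := exists_dg_of_posSemidef hR
  obtain ⟨Q, b, hQ, rfl, hb⟩ := exists_dg_of_posSemidef hτ.1
  have hVt := tensProd_unitary (k := k) (U := fun _ => V) fun _ => hV
  rw [matFun_dg hQ, tensProd_dg, trace_mul_dg]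
  set Vt := tensProd (fun _ : Fin k => V)
  have hP : ∀ a, 0 ≤ ((Vtᴴ * dg Q b * Vt) a a).re := by
    intro a
    rw [conj_dg_diag]
    exact Finset.sum_nonneg fun i _ => mul_nonneg (Complex.normSq_nonneg _) (hb i)
  calc ∑ a : Fin k → B, (∏ i, r (a i)) * ((Vtᴴ * dg Q (fun i => b i ^ t) * Vt) a a).re
      ≤ ∑ a : Fin k → B, (∏ i, r (a i)) * ((Vtᴴ * dg Q b * Vt) a a).re ^ t := by
        refine Finset.sum_le_sum fun a _ => mul_le_mul_of_nonneg_left ?_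
          (Finset.prod_nonneg fun i _ => hr _)
        exact conj_dg_rpow_diag_le hVt hQ hb ht0.le ht1 a
    _ ≤ c ^ k * (∑ a, ((Vtᴴ * dg Q b * Vt) a a).re) ^ t :=
        sum_prod_rpow_le hc hr (sum_rpow_le_of_schattenBall hV ht0 ht1 h) k _ hP
    _ = c ^ k := by
        rw [sum_conj_diag hVt, hτ.2]
        simp

end

section

variable {B : Type*} [Fintype B] [DecidableEq B] {k : ℕ}

/-- The test operator `√ρ V diag(w^{-t}) Vᴴ √ρ`. -/
def testOp (t : ℝ) (ρ V : Matrix B B ℂ) (w : B → ℝ) : Matrix B B ℂ :=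
  matFun Real.sqrt ρ * dg V (fun i => w i ^ (-t)) * matFun Real.sqrt ρ

lemma testOp_posSemidef {ρ V : Matrix B B ℂ} (hρ : ρ.PosSemidef) {w : B → ℝ} (hw : ∀ i, 0 ≤ w i)
    (t : ℝ) : (testOp t ρ V w).PosSemidef := by
  have h := (dg_posSemidef V fun i => Real.rpow_nonneg (hw i) (-t)).mul_mul_conjTranspose_same
    (matFun Real.sqrt ρ)
  rwa [(matFun_posSemidef hρ fun x _ => Real.sqrt_nonneg x).1.eq] at h

lemma testOp_tensProd {ρ V : Fin k → Matrix B B ℂ} (hρ : ∀ i, (ρ i).PosSemidef)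
    {w : Fin k → B → ℝ} (hw : ∀ i b, 0 ≤ w i b) (t : ℝ) :
    testOp t (tensProd ρ) (tensProd V) (fun a => ∏ i, w i (a i)) =
      tensProd (fun i => testOp t (ρ i) (V i) (w i)) := by
  unfold testOp
  rw [← tensProd_mul, ← tensProd_mul, tensProd_dg, matFun_sqrt_tensProd hρ]
  simp only [Real.finsetProd_rpow _ _ (fun i _ => hw i _)]

lemma matFun_rpow_smul {A : Matrix B B ℂ} (hA : A.PosSemidef) {M : ℝ} (hM : 0 ≤ M) (t : ℝ) :
    matFun (fun x => x ^ t) (M • A) = M ^ t • matFun (fun x => x ^ t) A := by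
  obtain ⟨U, v, hU, rfl, hv⟩ := exists_dg_of_posSemidef hA
  rw [← dg_smul, matFun_dg hU, matFun_dg hU, ← dg_smul]
  simp only [Real.mul_rpow hM (hv _)]

lemma qFid_le_trace_testOp {ρ V ω τ : Matrix B B ℂ} (hρ : ρ.PosSemidef) (hV : Vᴴ * V = 1)
    {w : B → ℝ} (hw : ∀ i, 0 < w i) (hw1 : ∑ i, w i = 1) {t : ℝ} (ht0 : 0 < t) (ht1 : t ≤ 1)
    (hω : IsDensity ω) (hτ : IsDensity τ) {M : ℝ} (hM : 0 ≤ M) (h : (M • τ - ω).PosSemidef) :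
    qFid ρ ω ≤ M ^ t * (matFun (fun x => x ^ t) τ * testOp t ρ V w).trace.re := by
  have hmono := matFun_rpow_mono hω.1 h ht0.le ht1
  rw [matFun_rpow_smul hτ.1 hM] at hmono
  have hpos := trace_mul_re_nonneg hmono (testOp_posSemidef (V := V) hρ (fun i => (hw i).le) t)
  obtain ⟨U, a, hU, rfl, ha⟩ := exists_dg_of_posSemidef hω.1
  have ha1 : ∑ i, a i = 1 := by rw [← dg_trace_re hU, hω.2]; rfl
  have h1 := qFid_le hρ hU hV ha hw ha1 hw1 ht0 ht1
  rw [Matrix.sub_mul, trace_sub, Complex.sub_re, Matrix.smul_mul, trace_smul, Complex.real_smul,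
    Complex.re_ofReal_mul, matFun_dg hU] at hpos
  rw [Matrix.trace_mul_comm] at h1
  unfold testOp at hpos ⊢
  linarith

lemma exists_qFid_cqPow_le {X J : Type*} [Fintype J] {W : X → Matrix B B ℂ}
    (hW : ∀ x, IsDensity (W x)) (x : J → X) {V : J → Matrix B B ℂ} (hV : ∀ j, (V j)ᴴ * V j = 1)
    {w : J → B → ℝ} (hw : ∀ j b, 0 < w j b) (hw1 : ∀ j, ∑ b, w j b = 1) {p : J → ℝ}
    (hp : ∀ j, 0 ≤ p j) (hp1 : ∑ j, p j = 1) {t c : ℝ} (ht0 : 0 < t) (ht1 : t ≤ 1) (hc : 0 ≤ c)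
    (h : ∀ Y ∈ schattenBall B t⁻¹,
      (Y * ∑ j, p j • testOp t (W (x j)) (V j) (w j)).trace.re ≤ c)
    {n : ℕ} {M : ℝ} (hM : 0 ≤ M) {τ : Matrix (Fin n → B) (Fin n → B) ℂ} (hτ : IsDensity τ)
    {W' : (Fin n → X) → Matrix (Fin n → B) (Fin n → B) ℂ} (hW' : ∀ xs, IsDensity (W' xs))
    (hle : ∀ xs, (M • τ - W' xs).PosSemidef) :
    ∃ xs, qFid (cqPow W n xs) (W' xs) ≤ M ^ t * c ^ n := by
  by_contra! hcon
  set G : J → Matrix B B ℂ := fun j => testOp t (W (x j)) (V j) (w j) with hG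
  set R := ∑ j, p j • G j with hR
  have hRpos : R.PosSemidef := posSemidef_sum _ fun j _ =>
    (testOp_posSemidef (hW _).1 (fun b => (hw j b).le) t).smul (hp j)
  have hdual := trace_tensProd_le hRpos hc ht0 ht1 h hτ
  rw [← sum_smul_tensProd, Matrix.mul_sum, trace_sum, Complex.re_sum] at hdual
  have hsum : ∑ js : Fin n → J, ∏ i, p (js i) = 1 := by
    rw [← Fintype.piFinset_univ, ← Finset.prod_univ_sum]
    simp [hp1]
  have hterm : ∀ js : Fin n → J, M ^ t * c ^ n <
      M ^ t * (matFun (fun y => y ^ t) τ * tensProd (fun i => G (js i))).trace.re := by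
    intro js
    refine (hcon fun i => x (js i)).trans_le ?_
    have := qFid_le_trace_testOp (ρ := tensProd fun i => W (x (js i)))
      (V := tensProd fun i => V (js i)) (w := fun a => ∏ i, w (js i) (a i)) (t := t)
      (tensProd_posSemidef fun i => (hW _).1) (tensProd_unitary fun i => hV _)
      (fun a => Finset.prod_pos fun i _ => hw _ _)
      (by
        rw [← Fintype.piFinset_univ, ← Finset.prod_univ_sum]
        simp [hw1]) ht0 ht1 (hW' fun i => x (js i)) hτ hM (hle _)
    rwa [testOp_tensProd (fun i => (hW _).1) (fun i b => (hw _ b).le)] at this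
  have hq : ∀ js : Fin n → J, 0 ≤ ∏ i, p (js i) := fun js => Finset.prod_nonneg fun i _ => hp _
  obtain ⟨js₀, -, hjs₀⟩ : ∃ js ∈ (Finset.univ : Finset (Fin n → J)), 0 < ∏ i, p (js i) := by
    by_contra! hno
    have := Finset.sum_nonpos hno
    linarith
  have hlt : ∑ js : Fin n → J, (∏ i, p (js i)) * (M ^ t * c ^ n) <
      ∑ js : Fin n → J, (∏ i, p (js i)) *
        (M ^ t * (matFun (fun y => y ^ t) τ * tensProd (fun i => G (js i))).trace.re) :=
    Finset.sum_lt_sum (fun js _ => mul_le_mul_of_nonneg_left (hterm js).le (hq js))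
      ⟨js₀, Finset.mem_univ _, mul_lt_mul_of_pos_left (hterm js₀) hjs₀⟩
  rw [← Finset.sum_mul, hsum, one_mul] at hlt
  have hfin : ∑ js : Fin n → J, (∏ i, p (js i)) *
        (M ^ t * (matFun (fun y => y ^ t) τ * tensProd (fun i => G (js i))).trace.re) =
      M ^ t * ∑ js : Fin n → J, (matFun (fun y => y ^ t) τ *
        ((∏ i, p (js i)) • tensProd (fun i => G (js i)))).trace.re := by
    rw [Finset.mul_sum]
    refine Finset.sum_congr rfl fun js _ => ?_
    rw [Matrix.mul_smul, trace_smul, Complex.real_smul, Complex.re_ofReal_mul]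
    ring
  rw [hfin] at hlt
  exact absurd hlt (not_lt.mpr (mul_le_mul_of_nonneg_left hdual (Real.rpow_nonneg hM t)))

end

section

variable {B : Type*} [Fintype B] [DecidableEq B]

lemma isClosed_posSemidef : IsClosed {Y : Matrix B B ℂ | Y.PosSemidef} := by
  have h : {Y : Matrix B B ℂ | Y.PosSemidef} =
      {Y | Yᴴ = Y} ∩ ⋂ x : B → ℂ, {Y | 0 ≤ star x ⬝ᵥ (Y *ᵥ x)} := by
    ext Y
    simp only [Set.mem_ofPred_eq, Set.mem_inter_iff, Set.mem_iInter]
    exact posSemidef_iff_dotProduct_mulVec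
  rw [h]
  refine (isClosed_eq (by fun_prop) continuous_id).inter (isClosed_iInter fun x => ?_)
  exact isClosed_le continuous_const (by fun_prop)

lemma sum_rpow_le_one_of_dg_mem {U : Matrix B B ℂ} (hU : Uᴴ * U = 1) {y : B → ℝ} {q : ℝ}
    (h : dg U y ∈ schattenBall B q) : ∑ i, y i ^ q ≤ 1 := by
  have h2 := h.2 U hU
  have e : Uᴴ * dg U y * U = diagonal (fun i => (y i : ℂ)) := by
    unfold dg
    calc Uᴴ * (U * diagonal (fun i => (y i : ℂ)) * Uᴴ) * U
        = (Uᴴ * U) * diagonal (fun i => (y i : ℂ)) * (Uᴴ * U) := by simp only [Matrix.mul_assoc]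
      _ = _ := by rw [hU, Matrix.one_mul, Matrix.mul_one]
  rw [e] at h2
  simpa using h2

lemma isClosed_schattenBall {q : ℝ} (hq : 0 ≤ q) : IsClosed (schattenBall B q) := by
  have h : schattenBall B q = {Y | Y.PosSemidef} ∩ ⋂ U : {U : Matrix B B ℂ // Uᴴ * U = 1},
      {Y | ∑ i, ((U.1ᴴ * Y * U.1) i i).re ^ q ≤ 1} := by
    ext Y
    simp [schattenBall]
  rw [h]
  refine isClosed_posSemidef.inter (isClosed_iInter fun U => isClosed_le ?_ continuous_const)
  refine continuous_finsetSum _ fun i _ => ?_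
  refine Continuous.rpow_const ?_ fun _ => Or.inr hq
  exact Complex.continuous_re.comp (((continuous_const.matrix_mul continuous_id).matrix_mul
    continuous_const).matrix_elem i i)

lemma norm_le_of_mem_schattenBall {q : ℝ} (hq : 1 ≤ q) {Y : Matrix B B ℂ}
    (hY : Y ∈ schattenBall B q) (i j : B) : ‖Y i j‖ ≤ Real.sqrt (Fintype.card B) := by
  obtain ⟨U, y, hU, rfl, hy⟩ := exists_dg_of_posSemidef hY.1
  have h := sum_rpow_le_one_of_dg_mem hU hY
  have hy1 : ∀ i, y i ≤ 1 := by
    intro i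
    by_contra! hi
    have h1 : y i ^ q ≤ 1 :=
      (Finset.single_le_sum (f := fun i => y i ^ q) (fun j _ => Real.rpow_nonneg (hy j) q)
        (Finset.mem_univ i)).trans h
    exact absurd (Real.one_lt_rpow hi (by linarith)) (not_lt.mpr h1)
  have h2 := trace_mul_conjTranspose_re (dg U y)
  rw [(dg_isHermitian U y).eq, dg_mul hU, dg_trace_re hU] at h2
  have h3 : ∑ i, y i * y i ≤ ∑ _i : B, (1 : ℝ) :=
    Finset.sum_le_sum fun i _ => mul_le_one₀ (hy1 i) (hy i) (hy1 i)
  rw [h2, Finset.sum_const, Finset.card_univ, nsmul_one] at h3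
  generalize dg U y = Z at h3
  apply Real.le_sqrt_of_sq_le
  exact (Finset.single_le_sum (f := fun p : B × B => ‖Z p.1 p.2‖ ^ 2)
    (fun p _ => sq_nonneg _) (Finset.mem_univ (i, j))).trans h3

lemma isCompact_schattenBall {q : ℝ} (hq : 1 ≤ q) : IsCompact (schattenBall B q) := by
  have hK : IsCompact (Set.pi Set.univ fun _ : B => Set.pi Set.univ fun _ : B =>
      Metric.closedBall (0 : ℂ) (Real.sqrt (Fintype.card B))) :=
    isCompact_univ_pi fun _ => isCompact_univ_pi fun _ => isCompact_closedBall _ _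
  refine hK.of_isClosed_subset (isClosed_schattenBall (by linarith)) fun Y hY i _ j _ => ?_
  rw [mem_closedBall_zero_iff]
  exact norm_le_of_mem_schattenBall hq hY i j

lemma convex_schattenBall {q : ℝ} (hq : 1 ≤ q) : Convex ℝ (schattenBall B q) := by
  intro Y hY Z hZ a b ha hb hab
  refine ⟨(hY.1.smul ha).add (hZ.1.smul hb), fun U hU => ?_⟩
  have hd : ∀ {Y : Matrix B B ℂ}, Y.PosSemidef → ∀ i, 0 ≤ ((Uᴴ * Y * U) i i).re := fun hY i =>
    (Complex.le_def.mp (hY.conjTranspose_mul_mul_same U).diag_nonneg).1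
  have he : ∀ i, ((Uᴴ * (a • Y + b • Z) * U) i i).re =
      a * ((Uᴴ * Y * U) i i).re + b * ((Uᴴ * Z * U) i i).re := by
    intro i
    simp [Matrix.mul_add, Matrix.add_mul]
  calc ∑ i, ((Uᴴ * (a • Y + b • Z) * U) i i).re ^ q
      ≤ ∑ i, (a * ((Uᴴ * Y * U) i i).re ^ q + b * ((Uᴴ * Z * U) i i).re ^ q) := by
        refine Finset.sum_le_sum fun i _ => ?_
        rw [he]
        exact (convexOn_rpow hq).2 (hd hY.1 i) (hd hZ.1 i) ha hb hab
    _ = a * ∑ i, ((Uᴴ * Y * U) i i).re ^ q + b * ∑ i, ((Uᴴ * Z * U) i i).re ^ q := by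
        rw [Finset.sum_add_distrib, Finset.mul_sum, Finset.mul_sum]
    _ ≤ a * 1 + b * 1 := by gcongr <;> [exact hY.2 U hU; exact hZ.2 U hU]
    _ = 1 := by linarith

lemma zero_mem_schattenBall {q : ℝ} (hq : 1 ≤ q) : (0 : Matrix B B ℂ) ∈ schattenBall B q := by
  refine ⟨PosSemidef.zero, fun U _ => ?_⟩
  simp [Real.zero_rpow (by linarith : q ≠ 0)]

lemma continuous_trace_mul_re (G : Matrix B B ℂ) :
    Continuous fun Y : Matrix B B ℂ => (Y * G).trace.re :=
  Complex.continuous_re.comp (continuous_id.matrix_mul continuous_const).matrix_trace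

/-- A minimax principle over the Schatten ball. -/
lemma exists_weights_of_schattenBall {I : Type*} {q : ℝ} (hq : 1 ≤ q) (G : I → Matrix B B ℂ)
    {c : ℝ} (h : ∀ Y ∈ schattenBall B q, ∃ i, (Y * G i).trace.re < c) :
    ∃ (s : Finset I) (p : s → ℝ), (∀ j, 0 ≤ p j) ∧ ∑ j, p j = 1 ∧
      ∀ Y ∈ schattenBall B q, (Y * ∑ j : s, p j • G j).trace.re < c := by
  obtain ⟨s, hs⟩ := (isCompact_schattenBall (B := B) hq).elim_finite_subcover
    (fun i => {Y : Matrix B B ℂ | (Y * G i).trace.re < c})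
    (fun i => isOpen_lt (continuous_trace_mul_re _) continuous_const)
    (fun Y hY => Set.mem_iUnion.mpr (h Y hY))
  refine ⟨s, ?_⟩
  let f : Matrix B B ℂ → (s → ℝ) → ℝ := fun Y p => -∑ j : s, p j * (Y * G j).trace.re
  have hlin1 : ∀ p : s → ℝ, ∃ l : Matrix B B ℂ →ₗ[ℝ] ℝ, ∀ Y, l Y = f Y p := fun p =>
    ⟨{ toFun := fun Y => f Y p
       map_add' := fun Y Z => by
        simp only [f, Matrix.add_mul, trace_add, Complex.add_re, mul_add, Finset.sum_add_distrib,
          neg_add]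
       map_smul' := fun a Y => by
        simp only [f, Matrix.smul_mul, trace_smul, Complex.real_smul, Complex.re_ofReal_mul,
          RingHom.id_apply, smul_eq_mul, mul_neg, Finset.mul_sum]
        congr 1
        exact Finset.sum_congr rfl fun j _ => by ring }, fun _ => rfl⟩
  have hlin2 : ∀ Y : Matrix B B ℂ, ∃ l : (s → ℝ) →ₗ[ℝ] ℝ, ∀ p, l p = f Y p := fun Y =>
    ⟨{ toFun := fun p => f Y p
       map_add' := fun p p' => by
        simp only [f, Pi.add_apply, add_mul, Finset.sum_add_distrib, neg_add]
       map_smul' := fun a p => by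
        simp only [f, Pi.smul_apply, RingHom.id_apply, smul_eq_mul, mul_neg, Finset.mul_sum]
        congr 1
        exact Finset.sum_congr rfl fun j _ => by ring }, fun _ => rfl⟩
  have hc1 : ∀ p : s → ℝ, Continuous fun Y => f Y p := fun p =>
    (continuous_finsetSum _ fun j _ => continuous_const.mul (continuous_trace_mul_re _)).neg
  have hc2 : ∀ Y, Continuous fun p => f Y p := fun Y =>
    (continuous_finsetSum _ fun j _ => (continuous_apply j).mul continuous_const).neg
  obtain ⟨p, hp, hlt⟩ := Sion.exists_lt_iInf_of_lt_iInf_of_finite (f := f)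
    (X := schattenBall B q) (Y := stdSimplex ℝ s) ⟨0, zero_mem_schattenBall hq⟩
    (isCompact_schattenBall hq) (fun p _ => (hc1 p).lowerSemicontinuous.lowerSemicontinuousOn _)
    (fun p _ => by
      obtain ⟨l, hl⟩ := hlin1 p
      rw [← funext hl]
      exact (l.convexOn (convex_schattenBall hq)).quasiconvexOn)
    (convex_stdSimplex ℝ s) (fun Y _ => (hc2 Y).upperSemicontinuous.upperSemicontinuousOn _)
    (fun Y _ => by
      obtain ⟨l, hl⟩ := hlin2 Y
      rw [← funext hl]
      exact (l.concaveOn (convex_stdSimplex ℝ s)).quasiconcaveOn)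
    (convex_schattenBall hq)
    (Set.finite_range fun j : s => (Pi.single j (1 : ℝ) : s → ℝ))
    (by rintro _ ⟨j, rfl⟩; exact single_mem_stdSimplex ℝ j) (t := -c)
    (by
      intro Y hY
      obtain ⟨i, hi, hYi⟩ := Set.mem_iUnion₂.mp (hs hY)
      refine ⟨_, ⟨⟨i, hi⟩, rfl⟩, ?_⟩
      simp only [f, neg_lt_neg_iff]
      rw [Finset.sum_eq_single ⟨i, hi⟩ (fun j _ hj => by simp [Pi.single_eq_of_ne hj])
        (fun h => absurd (Finset.mem_univ _) h)]
      simpa using hYi)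
  refine ⟨p, hp.1, hp.2, fun Y hY => ?_⟩
  have := hlt Y hY
  simp only [f, neg_lt_neg_iff] at this
  rw [Matrix.mul_sum, trace_sum, Complex.re_sum]
  simpa only [Matrix.mul_smul, trace_smul, Complex.real_smul, Complex.re_ofReal_mul] using this

end

section

variable {B : Type*} [Fintype B] [DecidableEq B]

lemma IsDensity.exists_dg {σ : Matrix B B ℂ} (hσ : IsDensity σ) :
    ∃ (U : Matrix B B ℂ) (v : B → ℝ), Uᴴ * U = 1 ∧ σ = dg U v ∧ (∀ i, 0 ≤ v i) ∧
      ∑ i, v i = 1 := by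
  obtain ⟨U, v, hU, rfl, hv⟩ := exists_dg_of_posSemidef hσ.1
  refine ⟨U, v, hU, rfl, hv, ?_⟩
  rw [← dg_trace_re hU, hσ.2]
  rfl

lemma matFun_zero {f : ℝ → ℝ} (hf : f 0 = 0) : matFun f (0 : Matrix B B ℂ) = 0 := by
  have h0 : (0 : Matrix B B ℂ) = dg 1 (fun _ => 0) := by simp [dg]
  rw [h0, matFun_dg (by simp)]
  simp [dg, hf]

/-- The trace functional `Tr (σ^{(1−α)/(2α)} ρ σ^{(1−α)/(2α)})^α` of the sandwiched divergence. -/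
def sandQ (α : ℝ) (ρ σ : Matrix B B ℂ) : ℝ :=
  ((matFun (fun t => t ^ α)
    (matFun (fun t => t ^ ((1 - α) / (2 * α))) σ * ρ *
      matFun (fun t => t ^ ((1 - α) / (2 * α))) σ)).trace).re

lemma matFun_rpow_half_mul_self {σ : Matrix B B ℂ} (hσ : σ.PosSemidef) {s t : ℝ} (hs : 0 ≤ s)
    (hst : s + s = t) :
    matFun (fun x => x ^ s) σ * matFun (fun x => x ^ s) σ = matFun (fun x => x ^ t) σ := by
  obtain ⟨U, v, hU, rfl, hv⟩ := exists_dg_of_posSemidef hσ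
  rw [matFun_dg hU, matFun_dg hU, dg_mul hU]
  congr 1
  ext i
  rw [← Real.rpow_add_of_nonneg (hv i) hs hs, hst]

lemma sandwich_posSemidef {A C : Matrix B B ℂ} (hA : A.PosSemidef) (hC : C.PosSemidef) :
    (C * A * C).PosSemidef := by
  have h := hA.mul_mul_conjTranspose_same C
  rwa [hC.1.eq] at h

lemma sandQ_eq {ρ σ : Matrix B B ℂ} (hρ : ρ.PosSemidef) (hσ : σ.PosSemidef) {α : ℝ}
    (hα0 : 0 < α) (hα1 : α ≤ 1) :
    sandQ α ρ σ = (matFun (fun x => x ^ α) (matFun Real.sqrt ρ *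
      matFun (fun x => x ^ ((1 - α) / α)) σ * matFun Real.sqrt ρ)).trace.re := by
  have hs : 0 ≤ (1 - α) / (2 * α) := div_nonneg (by linarith) (by linarith)
  have hst : (1 - α) / (2 * α) + (1 - α) / (2 * α) = (1 - α) / α := by field_simp; ring
  unfold sandQ
  rw [← matFun_rpow_half_mul_self hσ hs hst]
  have hS := matFun_posSemidef hσ (f := fun x => x ^ ((1 - α) / (2 * α)))
    fun x hx => Real.rpow_nonneg hx _
  have hP := matFun_posSemidef hρ (f := Real.sqrt) fun x _ => Real.sqrt_nonneg x
  have hPP := matFun_sqrt_mul_self hρ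
  set T := matFun (fun x => x ^ ((1 - α) / (2 * α))) σ
  set P := matFun Real.sqrt ρ
  have e1 : T * ρ * T = (T * P) * (P * T) := by
    rw [← hPP]; simp only [Matrix.mul_assoc]
  have e2 : P * (T * T) * P = (P * T) * (T * P) := by simp only [Matrix.mul_assoc]
  have h1 := (sandwich_posSemidef hρ hS).1
  have hTT : (T * T).PosSemidef := by
    have := posSemidef_self_mul_conjTranspose T
    rwa [hS.1.eq] at this
  have h2 := (sandwich_posSemidef hTT hP).1
  rw [e1] at h1 ⊢
  rw [e2] at h2 ⊢
  exact trace_matFun_mul_comm h1 h2 _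

lemma sandQ_nonneg {ρ σ : Matrix B B ℂ} (hρ : ρ.PosSemidef) (hσ : σ.PosSemidef) (α : ℝ) :
    0 ≤ sandQ α ρ σ := by
  have hS := matFun_posSemidef hσ (f := fun x => x ^ ((1 - α) / (2 * α)))
    fun x hx => Real.rpow_nonneg hx _
  have h := matFun_posSemidef (sandwich_posSemidef hρ hS) (f := fun x => x ^ α)
    fun x hx => Real.rpow_nonneg hx _
  exact (Complex.le_def.mp h.trace_nonneg).1

lemma sandQ_eq_zero {ρ σ : Matrix B B ℂ} (hσ : σ.PosSemidef) {α : ℝ} (hα0 : 0 < α) (hα1 : α < 1)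
    (h : ρ * σ = 0) : sandQ α ρ σ = 0 := by
  have hs : 0 < (1 - α) / (2 * α) := div_pos (by linarith) (by linarith)
  obtain ⟨U, b, hU, rfl, hb⟩ := exists_dg_of_posSemidef hσ
  have h2 : ρ * matFun (fun x => x ^ ((1 - α) / (2 * α))) (dg U b) = 0 := by
    rw [matFun_dg hU]
    have : dg U (fun i => b i ^ ((1 - α) / (2 * α))) =
        dg U b * dg U (fun i => b i ^ ((1 - α) / (2 * α) - 1)) := by
      rw [dg_mul hU]
      congr 1
      ext i
      rcases (hb i).eq_or_lt with h0 | h0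
      · rw [← h0, zero_mul, Real.zero_rpow hs.ne']
      · rw [Real.rpow_sub_one h0.ne']
        field_simp
    rw [this, ← Matrix.mul_assoc, h, Matrix.zero_mul]
  unfold sandQ
  rw [Matrix.mul_assoc, h2, Matrix.mul_zero, matFun_zero (f := fun x => x ^ α) (Real.zero_rpow hα0.ne')]
  simp

lemma sandQ_le {ρ σ : Matrix B B ℂ} (hρ : IsDensity ρ) (hσ : IsDensity σ) {α : ℝ}
    (hα0 : 0 < α) (hα1 : α ≤ 1) : sandQ α ρ σ ≤ Fintype.card B + 1 := by
  rw [sandQ_eq hρ.1 hσ.1 hα0 hα1]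
  have ht : 0 ≤ (1 - α) / α := div_nonneg (by linarith) hα0.le
  have hP := matFun_posSemidef hρ.1 (f := Real.sqrt) fun x _ => Real.sqrt_nonneg x
  have hPP := matFun_sqrt_mul_self hρ.1
  obtain ⟨U, b, hU, rfl, hb, hb1⟩ := hσ.exists_dg
  rw [matFun_dg hU]
  have hA := sandwich_posSemidef
    (dg_posSemidef U (fun i => Real.rpow_nonneg (hb i) ((1 - α) / α))) hP
  have htr : (matFun Real.sqrt ρ * dg U (fun i => b i ^ ((1 - α) / α)) *
      matFun Real.sqrt ρ).trace.re ≤ 1 := by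
    have hle : ∀ i, b i ^ ((1 - α) / α) ≤ 1 := fun i => Real.rpow_le_one (hb i)
      (hb1 ▸ Finset.single_le_sum (fun j _ => hb j) (Finset.mem_univ i)) ht
    have h1 := trace_mul_re_nonneg hρ.1
      (dg_posSemidef U (v := fun i => 1 - b i ^ ((1 - α) / α)) fun i => sub_nonneg.mpr (hle i))
    rw [trace_mul_dg] at h1
    simp only [sub_mul, one_mul, Finset.sum_sub_distrib] at h1
    rw [sum_conj_diag hU, ← trace_mul_dg, hρ.2] at h1
    rw [Matrix.trace_mul_comm, ← Matrix.mul_assoc, hPP]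
    simpa using h1
  obtain ⟨V, a, hV, hAV, ha⟩ := exists_dg_of_posSemidef hA
  rw [hAV, dg_trace_re hV] at htr
  rw [hAV, matFun_dg hV, dg_trace_re hV]
  calc ∑ i, a i ^ α ≤ ∑ i, (1 + a i) := by
        refine Finset.sum_le_sum fun i _ => ?_
        rcases le_total (a i) 1 with h | h
        · have := Real.rpow_le_one (ha i) h hα0.le
          linarith [ha i]
        · have := Real.rpow_le_rpow_of_exponent_le h hα1
          rw [Real.rpow_one] at this
          linarith
    _ ≤ _ := by
        rw [Finset.sum_add_distrib]
        simpa using htr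

lemma le_sum_rpow_of_forall_weights {a : B → ℝ} (ha : ∀ i, 0 ≤ a i) {α c S : ℝ} (hα0 : 0 < α)
    (hα1 : α < 1) (hS0 : 0 ≤ S) (hS1 : S ≤ 1) [Nonempty B]
    (h : ∀ w : B → ℝ, (∀ i, 0 < w i) → ∑ i, w i = 1 →
      c ≤ S ^ ((1 - α) / α) * ∑ i, a i * w i ^ (-((1 - α) / α))) :
    c ≤ (∑ i, a i ^ α) ^ α⁻¹ := by
  have ht : 0 < (1 - α) / α := div_pos (by linarith) hα0
  set t := (1 - α) / α with htdef
  have hαt : α * t = 1 - α := by rw [htdef]; field_simp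
  have hpα : ∀ i, 0 ≤ a i ^ α := fun i => Real.rpow_nonneg (ha i) α
  set Q := ∑ i, a i ^ α with hQ
  have hQ0 : 0 ≤ Q := Finset.sum_nonneg fun i _ => hpα i
  have hcard : (0 : ℝ) < Fintype.card B := by exact_mod_cast Fintype.card_pos
  have key : ∀ ε : ℝ, 0 < ε → c ≤ (Q + Fintype.card B * ε) ^ t * Q := by
    intro ε hε
    have hD : 0 < Q + Fintype.card B * ε := by positivity
    have hw0 : ∀ i, 0 < a i ^ α + ε := fun i => by linarith [hpα i]
    refine (h (fun i => (a i ^ α + ε) / (Q + Fintype.card B * ε)) (fun i => div_pos (hw0 i) hD)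
      ?_).trans ?_
    · rw [← Finset.sum_div, Finset.sum_add_distrib, ← hQ]
      simp only [Finset.sum_const, Finset.card_univ, nsmul_eq_mul]
      exact div_self hD.ne'
    · have hterm : ∀ i, a i * ((a i ^ α + ε) / (Q + Fintype.card B * ε)) ^ (-t) ≤
          (Q + Fintype.card B * ε) ^ t * a i ^ α := by
        intro i
        rcases (ha i).eq_or_lt with h0 | h0
        · rw [← h0, zero_mul, Real.zero_rpow hα0.ne', mul_zero]
        · rw [Real.div_rpow (hw0 i).le hD.le, Real.rpow_neg hD.le, div_inv_eq_mul]
          have h1 : (a i ^ α + ε) ^ (-t) ≤ (a i ^ α) ^ (-t) :=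
            Real.rpow_le_rpow_of_nonpos (Real.rpow_pos_of_pos h0 α) (by linarith) (by linarith)
          have h2 : a i * (a i ^ α) ^ (-t) = a i ^ α := by
            rw [← Real.rpow_mul h0.le, ← Real.rpow_one_add' h0.le]
            · congr 1; linarith
            · linarith
          calc a i * ((a i ^ α + ε) ^ (-t) * (Q + Fintype.card B * ε) ^ t)
              ≤ a i * ((a i ^ α) ^ (-t) * (Q + Fintype.card B * ε) ^ t) := by gcongr
            _ = _ := by rw [← mul_assoc, h2, mul_comm]
      have hsum := Finset.sum_le_sum fun i (_ : i ∈ Finset.univ) => hterm i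
      rw [← Finset.mul_sum, ← hQ] at hsum
      have hnn : 0 ≤ ∑ i, a i * ((a i ^ α + ε) / (Q + Fintype.card B * ε)) ^ (-t) :=
        Finset.sum_nonneg fun i _ => mul_nonneg (ha i)
          (Real.rpow_nonneg (div_pos (hw0 i) hD).le _)
      exact (mul_le_of_le_one_left hnn (Real.rpow_le_one hS0 hS1 ht.le)).trans hsum
  have hlim : Filter.Tendsto (fun ε : ℝ => (Q + Fintype.card B * ε) ^ t * Q)
      (nhdsWithin 0 (Set.Ioi 0)) (nhds ((Q + Fintype.card B * 0) ^ t * Q)) := by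
    refine Filter.Tendsto.mono_left (Continuous.tendsto ?_ 0) nhdsWithin_le_nhds
    exact (Continuous.rpow_const (by fun_prop) fun _ => Or.inr ht.le).mul continuous_const
  have hle := ge_of_tendsto hlim (Filter.eventually_of_mem self_mem_nhdsWithin key)
  have hfin : (Q + Fintype.card B * 0) ^ t * Q = Q ^ α⁻¹ := by
    have hα : α⁻¹ = t + 1 := by rw [htdef]; field_simp; ring
    rw [mul_zero, add_zero, hα, Real.rpow_add_one' hQ0 (by linarith)]
  rwa [hfin] at hle

/-- From a point of the Schatten ball to a density matrix. -/
lemma exists_density_of_forall_le [Nonempty B] {X : Type*} [Nonempty X] {W : X → Matrix B B ℂ}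
    (hW : ∀ x, IsDensity (W x)) {α c : ℝ} (hα0 : 0 < α) (hα1 : α < 1) (hc : 0 < c)
    {Y : Matrix B B ℂ} (hY : Y ∈ schattenBall B ((1 - α) / α)⁻¹)
    (h : ∀ x, ∀ V : Matrix B B ℂ, Vᴴ * V = 1 → ∀ w : B → ℝ, (∀ i, 0 < w i) → ∑ i, w i = 1 →
      c ≤ (Y * testOp ((1 - α) / α) (W x) V w).trace.re) :
    ∃ σ, IsDensity σ ∧ ∀ x, c ≤ sandQ α (W x) σ ^ α⁻¹ := by
  have ht : 0 < (1 - α) / α := div_pos (by linarith) hα0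
  set t := (1 - α) / α with htdef
  obtain ⟨U, y, hU, rfl, hy⟩ := exists_dg_of_posSemidef hY.1
  have hS1 := sum_rpow_le_one_of_dg_mem hU hY
  set S := ∑ i, y i ^ t⁻¹ with hS
  have hyq : ∀ i, 0 ≤ y i ^ t⁻¹ := fun i => Real.rpow_nonneg (hy i) _
  have hS0 : 0 < S := by
    by_contra! hneg
    have hz : ∀ i, y i = 0 := by
      intro i
      have h1 := (Finset.sum_eq_zero_iff_of_nonneg fun i _ => hyq i).mp
        (le_antisymm hneg (Finset.sum_nonneg fun i _ => hyq i)) i (Finset.mem_univ i)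
      exact ((Real.rpow_eq_zero (hy i) (inv_ne_zero ht.ne')).mp h1)
    have hy0 : y = fun _ => 0 := funext hz
    have hcard : (0 : ℝ) < Fintype.card B := by exact_mod_cast Fintype.card_pos
    have h2 := h (Classical.arbitrary X) 1 (by simp) (fun _ => (Fintype.card B : ℝ)⁻¹)
      (fun _ => inv_pos.mpr hcard) (by simp [hcard.ne'])
    rw [hy0] at h2
    simp [dg] at h2
    linarith
  have hσ0 : ∀ i, 0 ≤ y i ^ t⁻¹ / S := fun i => div_nonneg (hyq i) hS0.le
  refine ⟨dg U (fun i => y i ^ t⁻¹ / S), ⟨dg_posSemidef U hσ0, ?_⟩, fun x => ?_⟩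
  · rw [dg_trace hU]
    have : ∑ i, y i ^ t⁻¹ / S = 1 := by rw [← Finset.sum_div, ← hS, div_self hS0.ne']
    exact_mod_cast this
  · have hP := matFun_posSemidef (hW x).1 (f := Real.sqrt) fun x _ => Real.sqrt_nonneg x
    rw [sandQ_eq (hW x).1 (dg_posSemidef U hσ0) hα0 hα1.le, ← htdef, matFun_dg hU]
    have hA := sandwich_posSemidef
      (dg_posSemidef U (fun i => Real.rpow_nonneg (hσ0 i) t)) hP
    have hYe : dg U y = S ^ t • dg U (fun i => (y i ^ t⁻¹ / S) ^ t) := by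
      rw [← dg_smul]
      congr 1
      ext i
      rw [Real.div_rpow (hyq i) hS0.le, Real.rpow_inv_rpow (hy i) ht.ne']
      have := Real.rpow_pos_of_pos hS0 t
      field_simp
    rw [hYe] at h
    set Z := dg U (fun i => (y i ^ t⁻¹ / S) ^ t)
    obtain ⟨V, a, hV, hAV, ha⟩ := exists_dg_of_posSemidef hA
    rw [hAV, matFun_dg hV, dg_trace_re hV]
    refine le_sum_rpow_of_forall_weights ha hα0 hα1 hS0.le hS1 fun w hw hw1 => ?_
    have h2 := h x V hV w hw hw1
    rw [Matrix.smul_mul, trace_smul, Complex.real_smul, Complex.re_ofReal_mul] at h2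
    have h3 : (Z * testOp t (W x) V w).trace = (matFun Real.sqrt (W x) * Z *
        matFun Real.sqrt (W x) * dg V (fun i => w i ^ (-t))).trace := by
      unfold testOp
      rw [← Matrix.mul_assoc, Matrix.trace_mul_comm]
      simp only [Matrix.mul_assoc]
    rwa [h3, hAV, dg_mul hV, dg_trace_re hV] at h2

lemma le_sandD {ρ σ : Matrix B B ℂ} (hρ : IsDensity ρ) (hσ : IsDensity σ) {α : ℝ}
    (hα0 : 0 < α) (hα1 : α < 1) :
    (((α - 1)⁻¹ * Real.log (Fintype.card B + 1) : ℝ) : EReal) ≤ sandD α ρ σ := by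
  unfold sandD
  rw [if_neg hα1.ne]
  split_ifs with h
  · exact le_top
  · rw [EReal.coe_le_coe_iff]
    refine mul_le_mul_of_nonpos_left ?_ (inv_nonpos.mpr (by linarith))
    change Real.log (sandQ α ρ σ) ≤ _
    rcases (sandQ_nonneg hρ.1 hσ.1 α).eq_or_lt with h0 | h0
    · rw [← h0, Real.log_zero]
      exact Real.log_nonneg (by linarith [(Nat.cast_nonneg (Fintype.card B) : (0 : ℝ) ≤ _)])
    · exact Real.log_le_log h0 (sandQ_le hρ hσ hα0 hα1.le)

lemma sandD_le {ρ σ : Matrix B B ℂ} (hσ : IsDensity σ) {α c : ℝ}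
    (hα0 : 0 < α) (hα1 : α < 1) (hc : 0 < c) (h : c ≤ sandQ α ρ σ ^ α⁻¹)
    (hQ0 : 0 ≤ sandQ α ρ σ) :
    sandD α ρ σ ≤ ((-((1 - α) / α)⁻¹ * Real.log c : ℝ) : EReal) := by
  have hQ : 0 < sandQ α ρ σ := by
    rcases hQ0.eq_or_lt with h0 | h0
    · rw [← h0, Real.zero_rpow (inv_ne_zero hα0.ne')] at h
      linarith
    · exact h0
  unfold sandD
  rw [if_neg hα1.ne, if_neg]
  · rw [EReal.coe_le_coe_iff]
    change (α - 1)⁻¹ * Real.log (sandQ α ρ σ) ≤ _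
    have h1 := Real.log_le_log hc h
    rw [Real.log_rpow hQ] at h1
    have h2 : α * Real.log c ≤ Real.log (sandQ α ρ σ) := by
      calc α * Real.log c ≤ α * (α⁻¹ * Real.log (sandQ α ρ σ)) := by gcongr
        _ = _ := by field_simp
    have h3 := mul_le_mul_of_nonpos_left h2 (inv_nonpos.mpr (by linarith : α - 1 ≤ 0))
    refine h3.trans_eq ?_
    have : α - 1 ≠ 0 := by linarith
    have : 1 - α ≠ 0 := by linarith
    rw [inv_div, show (α - 1) = -(1 - α) by ring, inv_neg]
    field_simp
  · rintro (⟨h1, -⟩ | ⟨-, h1⟩)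
    · linarith
    · exact hQ.ne' (sandQ_eq_zero hσ.1 hα0 hα1 h1)

lemma exists_trace_testOp_lt [Nonempty B] {X : Type*} [Fintype X] [Nonempty X]
    {W : X → Matrix B B ℂ} (hW : ∀ x, IsDensity (W x)) {α c : ℝ} (hα0 : 0 < α) (hα1 : α < 1)
    (hc : Real.exp (-((1 - α) / α) * (sandMI α W).toReal) < c) {Y : Matrix B B ℂ}
    (hY : Y ∈ schattenBall B ((1 - α) / α)⁻¹) :
    ∃ x, ∃ V : Matrix B B ℂ, Vᴴ * V = 1 ∧ ∃ w : B → ℝ, (∀ i, 0 < w i) ∧ ∑ i, w i = 1 ∧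
      (Y * testOp ((1 - α) / α) (W x) V w).trace.re < c := by
  by_contra! hcon
  have ht : 0 < (1 - α) / α := div_pos (by linarith) hα0
  have hc0 : 0 < c := (Real.exp_pos _).trans hc
  obtain ⟨σ, hσ, hx⟩ := exists_density_of_forall_le hW hα0 hα1 hc0 hY hcon
  have hle : sandMI α W ≤ ((-((1 - α) / α)⁻¹ * Real.log c : ℝ) : EReal) :=
    (iInf_le _ (⟨σ, hσ⟩ : {σ : Matrix B B ℂ // IsDensity σ})).trans
      (iSup_le fun x => sandD_le hσ hα0 hα1 hc0 (hx x) (sandQ_nonneg (hW x).1 hσ.1 α))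
  have hge : (((α - 1)⁻¹ * Real.log (Fintype.card B + 1) : ℝ) : EReal) ≤ sandMI α W :=
    le_iInf fun σ => (le_sandD (hW (Classical.arbitrary X)) σ.2 hα0 hα1).trans
      (le_iSup (fun x => sandD α (W x) σ.1) _)
  have hbot : sandMI α W ≠ ⊥ := fun h => by
    rw [h] at hge
    exact EReal.coe_ne_bot _ (le_bot_iff.mp hge)
  have h1 := EReal.toReal_le_toReal hle hbot (EReal.coe_ne_top _)
  rw [EReal.toReal_coe] at h1
  have h2 : Real.log c ≤ -((1 - α) / α) * (sandMI α W).toReal := by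
    have := mul_le_mul_of_nonneg_left h1 ht.le
    have e : (1 - α) / α * (-((1 - α) / α)⁻¹ * Real.log c) = -Real.log c := by
      rw [← mul_assoc, mul_neg, mul_inv_cancel₀ ht.ne']; ring
    rw [e] at this
    linarith
  rw [← Real.exp_log hc0] at hc
  exact absurd (Real.exp_lt_exp.mp hc) (not_lt.mpr h2)

end

section

variable {B : Type*} [Fintype B] [DecidableEq B]

/-- The one-shot bound for feasible simulations of the `n`-fold product channel. -/
lemma exists_qFid_cqPow_lt [Nonempty B] {X : Type*} [Fintype X] [Nonempty X]
    {W : X → Matrix B B ℂ} (hW : ∀ x, IsDensity (W x)) {α c : ℝ} (hα0 : 1 / 2 ≤ α) (hα1 : α < 1)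
    (hc : Real.exp (-((1 - α) / α) * (sandMI α W).toReal) < c)
    {n : ℕ} {M : ℝ} (hM : 0 ≤ M) {τ : Matrix (Fin n → B) (Fin n → B) ℂ} (hτ : IsDensity τ)
    {W' : (Fin n → X) → Matrix (Fin n → B) (Fin n → B) ℂ} (hW' : ∀ xs, IsDensity (W' xs))
    (hle : ∀ xs, (M • τ - W' xs).PosSemidef) :
    ∃ xs, qFid (cqPow W n xs) (W' xs) ≤ M ^ ((1 - α) / α) * c ^ n := by
  have hα : 0 < α := by linarith
  have ht0 : 0 < (1 - α) / α := div_pos (by linarith) hα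
  have ht1 : (1 - α) / α ≤ 1 := by rw [div_le_one hα]; linarith
  obtain ⟨s, p, hp, hp1, h⟩ := exists_weights_of_schattenBall (B := B) (one_le_inv₀ ht0 |>.mpr ht1)
    (fun i : {z : X × Matrix B B ℂ × (B → ℝ) //
        z.2.1ᴴ * z.2.1 = 1 ∧ (∀ b, 0 < z.2.2 b) ∧ ∑ b, z.2.2 b = 1} =>
      testOp ((1 - α) / α) (W i.1.1) i.1.2.1 i.1.2.2) (c := c) (fun Y hY => by
        obtain ⟨x, V, hV, w, hw, hw1, hlt⟩ := exists_trace_testOp_lt hW hα hα1 hc hY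
        exact ⟨⟨(x, V, w), hV, hw, hw1⟩, hlt⟩)
  exact exists_qFid_cqPow_le hW (fun j : s => j.1.1.1) (V := fun j => j.1.1.2.1)
    (fun j => j.1.2.1) (w := fun j => j.1.1.2.2) (fun j => j.1.2.2.1) (fun j => j.1.2.2.2)
    hp hp1 ht0 ht1 ((Real.exp_pos _).trans hc).le (fun Y hY => (h Y hY).le) hM hτ hW' hle

lemma qFid_nonneg (ρ σ : Matrix B B ℂ) : 0 ≤ qFid ρ σ := sq_nonneg _

lemma qPD_le_one (ρ σ : Matrix B B ℂ) : qPD ρ σ ≤ 1 := by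
  unfold qPD
  rw [Real.sqrt_le_one]
  linarith [qFid_nonneg ρ σ]

lemma one_sub_qFid_le_qPD (ρ σ : Matrix B B ℂ) : 1 - qFid ρ σ ≤ qPD ρ σ := by
  unfold qPD
  rcases le_total (1 - qFid ρ σ) 0 with h | h
  · exact h.trans (Real.sqrt_nonneg _)
  · apply Real.le_sqrt_of_sq_le
    have := qFid_nonneg ρ σ
    nlinarith

variable {Z : Type*} [Fintype Z]

lemma qEpsNS_nonneg (W : Z → Matrix B B ℂ) (M : ℝ) : 0 ≤ qEpsNS W M := by
  apply Real.sInf_nonneg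
  rintro e ⟨W', σ, -, -, -, rfl⟩
  exact Real.iSup_nonneg fun x => Real.sqrt_nonneg _

/-- The maximally mixed state. -/
lemma isDensity_maxMixed [Nonempty B] :
    IsDensity (((Fintype.card B : ℝ)⁻¹) • (1 : Matrix B B ℂ)) := by
  have hcard : (Fintype.card B : ℂ) ≠ 0 := by exact_mod_cast Fintype.card_ne_zero
  refine ⟨PosSemidef.one.smul (inv_nonneg.mpr (Nat.cast_nonneg _)), ?_⟩
  rw [trace_smul, trace_one, Complex.real_smul]
  push_cast
  exact inv_mul_cancel₀ hcard

lemma feasible_maxMixed [Nonempty B] {W : Z → Matrix B B ℂ} {M : ℝ} (hM : 1 ≤ M) :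
    (⨆ x, qPD (W x) (((Fintype.card B : ℝ)⁻¹) • (1 : Matrix B B ℂ))) ∈
      { e : ℝ | ∃ (W' : Z → Matrix B B ℂ) (σ : Matrix B B ℂ),
        (∀ x, IsDensity (W' x)) ∧ IsDensity σ ∧ (∀ x, (M • σ - W' x).PosSemidef) ∧
        e = ⨆ x, qPD (W x) (W' x) } := by
  refine ⟨fun _ => ((Fintype.card B : ℝ)⁻¹) • (1 : Matrix B B ℂ),
    ((Fintype.card B : ℝ)⁻¹) • (1 : Matrix B B ℂ), fun _ => isDensity_maxMixed,
    isDensity_maxMixed, fun _ => ?_, rfl⟩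
  have := (isDensity_maxMixed (B := B)).1.smul (sub_nonneg.mpr hM)
  rwa [sub_smul, one_smul] at this

lemma inv_card_le_qFid_maxMixed {ρ : Matrix B B ℂ} (hρ : IsDensity ρ) :
    (Fintype.card B : ℝ)⁻¹ ≤ qFid ρ (((Fintype.card B : ℝ)⁻¹) • (1 : Matrix B B ℂ)) := by
  have hPP := matFun_sqrt_mul_self hρ.1
  obtain ⟨U, a, hU, rfl, ha, ha1⟩ := hρ.exists_dg
  unfold qFid
  rw [Matrix.mul_smul, Matrix.smul_mul, Matrix.mul_one, hPP, ← dg_smul, matFun_dg hU,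
    dg_trace_re hU]
  have hle : ∀ i, a i ≤ 1 := fun i =>
    ha1 ▸ Finset.single_le_sum (fun j _ => ha j) (Finset.mem_univ i)
  have hc : 0 ≤ (Fintype.card B : ℝ)⁻¹ := inv_nonneg.mpr (Nat.cast_nonneg _)
  have h1 : Real.sqrt (Fintype.card B : ℝ)⁻¹ ≤
      ∑ i, Real.sqrt ((Fintype.card B : ℝ)⁻¹ * a i) := by
    simp only [Real.sqrt_mul hc]
    rw [← Finset.mul_sum]
    refine le_mul_of_one_le_right (Real.sqrt_nonneg _) ?_
    rw [← ha1]
    refine Finset.sum_le_sum fun i _ => Real.le_sqrt_of_sq_le ?_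
    nlinarith [ha i, hle i]
  calc (Fintype.card B : ℝ)⁻¹ = Real.sqrt (Fintype.card B : ℝ)⁻¹ ^ 2 := (Real.sq_sqrt hc).symm
    _ ≤ _ := by gcongr

lemma le_one_sub_qEpsNS [Nonempty B] [Nonempty Z] {W : Z → Matrix B B ℂ}
    (hW : ∀ x, IsDensity (W x)) {M : ℝ} (hM : 1 ≤ M) :
    (2 * Fintype.card B : ℝ)⁻¹ ≤ 1 - qEpsNS W M := by
  have hb : BddBelow { e : ℝ | ∃ (W' : Z → Matrix B B ℂ) (σ : Matrix B B ℂ),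
        (∀ x, IsDensity (W' x)) ∧ IsDensity σ ∧ (∀ x, (M • σ - W' x).PosSemidef) ∧
        e = ⨆ x, qPD (W x) (W' x) } := by
    refine ⟨0, ?_⟩
    rintro e ⟨W', σ, -, -, -, rfl⟩
    exact Real.iSup_nonneg fun x => Real.sqrt_nonneg _
  have h1 : qEpsNS W M ≤ ⨆ x, qPD (W x) (((Fintype.card B : ℝ)⁻¹) • (1 : Matrix B B ℂ)) :=
    csInf_le hb (feasible_maxMixed hM)
  have hcard : (1 : ℝ) ≤ Fintype.card B := by exact_mod_cast Fintype.card_pos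
  have hinv : (Fintype.card B : ℝ)⁻¹ ≤ 1 := inv_le_one_of_one_le₀ hcard
  have h2 : (⨆ x, qPD (W x) (((Fintype.card B : ℝ)⁻¹) • (1 : Matrix B B ℂ))) ≤
      1 - (Fintype.card B : ℝ)⁻¹ / 2 := by
    refine ciSup_le fun x => ?_
    have h3 := inv_card_le_qFid_maxMixed (hW x)
    unfold qPD
    rw [Real.sqrt_le_iff]
    exact ⟨by linarith, by nlinarith [sq_nonneg (Fintype.card B : ℝ)⁻¹]⟩
  rw [mul_inv]
  linarith

/-- The converse bound for a single order `α`. -/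
lemma one_sub_qEpsNS_cqPow_le [Nonempty B] {X : Type*} [Fintype X] [Nonempty X]
    {W : X → Matrix B B ℂ} (hW : ∀ x, IsDensity (W x)) {r : ℝ} (hr : 0 ≤ r) (n : ℕ) {α : ℝ}
    (hα0 : 1 / 2 ≤ α) (hα1 : α ≤ 1) :
    1 - qEpsNS (cqPow W n) (Real.exp (n * r)) ≤
      Real.exp (-(n : ℝ) * ((1 - α) / α) * ((sandMI α W).toReal - r)) := by
  rcases hα1.eq_or_lt with rfl | hα1
  · simpa using qEpsNS_nonneg (cqPow W n) (Real.exp (n * r))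
  set t := (1 - α) / α with ht
  set m := (sandMI α W).toReal with hm
  have hM : 1 ≤ Real.exp (n * r) := Real.one_le_exp (by positivity)
  have key : ∀ c, Real.exp (-t * m) < c →
      1 - qEpsNS (cqPow W n) (Real.exp (n * r)) ≤ Real.exp (n * r) ^ t * c ^ n := by
    intro c hc
    have : 1 - Real.exp (n * r) ^ t * c ^ n ≤ qEpsNS (cqPow W n) (Real.exp (n * r)) := by
      refine le_csInf ⟨_, feasible_maxMixed hM⟩ ?_
      rintro e ⟨W', σ, hW', hσ, hle, rfl⟩
      obtain ⟨xs, hxs⟩ := exists_qFid_cqPow_lt hW hα0 hα1 hc (Real.exp_pos _).le hσ hW' hle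
      have h1 := one_sub_qFid_le_qPD (cqPow W n xs) (W' xs)
      have h2 : qPD (cqPow W n xs) (W' xs) ≤ ⨆ xs, qPD (cqPow W n xs) (W' xs) :=
        le_ciSup (f := fun xs => qPD (cqPow W n xs) (W' xs))
          ⟨1, by rintro _ ⟨x, rfl⟩; exact qPD_le_one _ _⟩ xs
      linarith
    linarith
  have hlim : Filter.Tendsto (fun c : ℝ => Real.exp (n * r) ^ t * c ^ n)
      (nhdsWithin (Real.exp (-t * m)) (Set.Ioi (Real.exp (-t * m))))
      (nhds (Real.exp (n * r) ^ t * Real.exp (-t * m) ^ n)) :=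
    (Continuous.tendsto (by fun_prop) _).mono_left nhdsWithin_le_nhds
  have h := ge_of_tendsto hlim (Filter.eventually_of_mem self_mem_nhdsWithin key)
  refine h.trans_eq ?_
  rw [← Real.exp_mul, ← Real.exp_nat_mul, ← Real.exp_add]
  congr 1
  ring

lemma le_liminf_of_exp_bound {u : ℕ → ℝ} {C D : ℝ} (hD : 0 < D)
    (hlow : ∀ n, (2 * D ^ n)⁻¹ ≤ u n) (hup : ∀ n : ℕ, u n ≤ Real.exp (-(n : ℝ) * C)) :
    C ≤ Filter.liminf (fun n : ℕ => -(1 / (n : ℝ)) * Real.log (u n)) Filter.atTop := by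
  have hpos : ∀ n, 0 < u n := fun n => (by positivity : 0 < (2 * D ^ n)⁻¹).trans_le (hlow n)
  refine Filter.le_liminf_of_le ?_ ?_
  · refine Filter.IsCoboundedUnder.of_frequently_le (a := Real.log 2 + Real.log D)
      (Filter.Eventually.frequently ?_)
    filter_upwards [Filter.eventually_ge_atTop 1] with n hn
    have hn' : (1 : ℝ) ≤ n := by exact_mod_cast hn
    have h1 := Real.log_le_log (by positivity) (hlow n)
    rw [Real.log_inv, Real.log_mul (by norm_num) (by positivity), Real.log_pow] at h1
    have h2 : 0 < Real.log 2 := Real.log_pos (by norm_num)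
    rw [neg_mul, one_div, ← mul_neg, inv_mul_le_iff₀ (by linarith)]
    nlinarith
  · filter_upwards [Filter.eventually_ge_atTop 1] with n hn
    have hn' : (1 : ℝ) ≤ n := by exact_mod_cast hn
    have h1 := Real.log_le_log (hpos n) (hup n)
    rw [Real.log_exp] at h1
    rw [neg_mul, one_div, ← mul_neg, le_inv_mul_iff₀ (by linarith)]
    linarith

end

end ChannelSim

open ChannelSim in
/-- converse bound on the strong converse exponent for non-signaling assisted
classical-quantum channel simulation. -/
theorem statement0 {X : Type*} [Fintype X] [Nonempty X] {d : ℕ}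
    (W : X → Matrix (Fin d) (Fin d) ℂ) (hW : ∀ x, IsDensity (W x))
    (r : ℝ) (hr : 0 ≤ r) :
    (∀ n : ℕ, ∀ α : ℝ, 1 / 2 ≤ α → α ≤ 1 →
      1 - qEpsNS (cqPow W n) (Real.exp (n * r)) ≤
        Real.exp (-(n : ℝ) * ((1 - α) / α) * ((sandMI α W).toReal - r))) ∧
    (⨆ α : {a : ℝ // 1 / 2 ≤ a ∧ a ≤ 1},
        ((1 - α.1) / α.1) * ((sandMI α.1 W).toReal - r)) ≤
      Filter.liminf
        (fun n : ℕ => -(1 / (n : ℝ)) *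
          Real.log (1 - qEpsNS (cqPow W n) (Real.exp (n * r)))) Filter.atTop := by
  have hne : Nonempty (Fin d) := by
    by_contra hcon
    rw [not_nonempty_iff] at hcon
    have h := (hW (Classical.arbitrary X)).2
    simp [Matrix.trace] at h
  refine ⟨fun n α h0 h1 => one_sub_qEpsNS_cqPow_le hW hr n h0 h1, ?_⟩
  have : Nonempty {a : ℝ // 1 / 2 ≤ a ∧ a ≤ 1} := ⟨⟨1, by norm_num⟩⟩
  refine ciSup_le fun α => ?_
  refine le_liminf_of_exp_bound (D := d) (by exact_mod_cast Fin.pos_iff_nonempty.mpr hne)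
    (fun n => ?_) (fun n => ?_)
  · have h := le_one_sub_qEpsNS (W := cqPow W n) (fun xs => tensProd_density fun i => hW (xs i))
      (Real.one_le_exp (by positivity : 0 ≤ (n : ℝ) * r))
    simpa using h
  · have h := one_sub_qEpsNS_cqPow_le hW hr n α.2.1 α.2.2
    rwa [mul_assoc] at h
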